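/- arXiv:2512.02146 — 3 statements merged into one kernel-verified Lean document; each statement's English description precedes it below -/
import Mathlib

section
/- Let d ≥ 1 and let A = {x_n}_{n=1}^∞ be a sequence of nonzero vectors in ℝ^d such that lim_{n→∞} ‖x_n‖ = 0 and lim_{n→∞} ‖x_{n+1}‖/‖x_n‖ = 1. Then there exists a closed set E ⊆ [0,1]^d with μ(E) > 0 such that E contains no affine copy of the set {x_n : n ∈ ℕ}, i.e., for every invertible linear map T : ℝ^d → ℝ^d and every x ∈ ℝ^d, the set T({x_n : n ∈ ℕ}) + x is not contained in E. -/
open MeasureTheory Filter Set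

/-- The closed unit cube `[0,1]^d` in `ℝ^d`. -/
def unitCube (d : ℕ) : Set (EuclideanSpace ℝ (Fin d)) :=
  {y | ∀ i, y i ∈ Set.Icc (0 : ℝ) 1}

/-- A sequence of positive reals tending to `0` with consecutive ratios tending to `1` meets all
the intervals `[q ^ (2 * i + 1) * r, q ^ (2 * i) * r]` for a suitable `r`. -/
lemma exists_geometric_selection {a : ℕ → ℝ} (hpos : ∀ n, 0 < a n)
    (hlim : Tendsto a atTop (nhds 0))
    (hratio : Tendsto (fun n => a (n + 1) / a n) atTop (nhds 1)) {q : ℝ} (hq0 : 0 < q)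
    (hq1 : q < 1) :
    ∃ r, 0 < r ∧ r ≤ 1 ∧ ∃ m : ℕ → ℕ, ∀ i,
      q ^ (2 * i + 1) * r ≤ a (m i) ∧ a (m i) ≤ q ^ (2 * i) * r := by
  obtain ⟨n₀, hn₀⟩ := eventually_atTop.1
    ((hratio.eventually (eventually_gt_nhds hq1)).and
      (hlim.eventually (eventually_le_nhds zero_lt_one)))
  refine ⟨a n₀, hpos _, (hn₀ n₀ le_rfl).2, ?_⟩
  have key (j : ℕ) : ∃ n, q ^ (j + 1) * a n₀ ≤ a n ∧ a n ≤ q ^ j * a n₀ := by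
    classical
    have hex : ∃ n, n₀ ≤ n ∧ a n ≤ q ^ j * a n₀ := by
      have hp : 0 < q ^ j * a n₀ := mul_pos (pow_pos hq0 _) (hpos _)
      exact ((eventually_ge_atTop n₀).and (hlim.eventually (eventually_le_nhds hp))).exists
    obtain ⟨hge, hle⟩ := Nat.find_spec hex
    refine ⟨Nat.find hex, ?_, hle⟩
    rcases hge.eq_or_lt with h | h
    · rw [← h]
      exact mul_le_of_le_one_left (hpos _).le (pow_le_one₀ hq0.le hq1.le)
    · obtain ⟨k, hk⟩ : ∃ k, Nat.find hex = k + 1 := ⟨Nat.find hex - 1, by omega⟩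
      have hk₀ : n₀ ≤ k := by omega
      have hlt : q ^ j * a n₀ < a k := by
        have := Nat.find_min hex (m := k) (by omega)
        push Not at this
        exact this hk₀
      have hr := (lt_div_iff₀ (hpos k)).1 (hn₀ k hk₀).1
      rw [hk, pow_succ']
      nlinarith
  choose m hm using key
  exact ⟨fun i => m (2 * i), fun i => hm (2 * i)⟩

/-- A greedy small hitting set for a family of large subsets of a finite set. -/
lemma exists_small_hitting_set {α ι : Type*} [DecidableEq α] (A : Finset α) (P : Finset ι)
    (S : ι → Finset α) (hS : ∀ p ∈ P, S p ⊆ A) {N : ℕ} (hN : ∀ p ∈ P, N ≤ (S p).card)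
    {ε : ℝ} (hε : 0 ≤ ε) (hP : (P.card : ℝ) < Real.exp (ε * N)) :
    ∃ B ⊆ A, (B.card : ℝ) ≤ ε * A.card + 1 ∧ ∀ p ∈ P, ∃ b ∈ B, b ∈ S p := by
  rcases A.eq_empty_or_nonempty with rfl | hA
  · refine ⟨∅, subset_rfl, by simp, fun p hp => ?_⟩
    have h0 : S p = ∅ := Finset.subset_empty.1 (hS p hp)
    have hN0 : N = 0 := by simpa [h0] using hN p hp
    rw [hN0] at hP
    have : P.card < 1 := by exact_mod_cast (by simpa using hP : (P.card : ℝ) < 1)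
    have : 0 < P.card := Finset.card_pos.2 ⟨p, hp⟩
    omega
  have hA0 : (0 : ℝ) < A.card := by exact_mod_cast hA.card_pos
  have greedy (t : ℕ) : ∃ B ⊆ A, B.card ≤ t ∧
      ((P.filter fun p => ∀ b ∈ B, b ∉ S p).card : ℝ) ≤
        P.card * Real.exp (-(N / A.card) * t) := by
    induction t with
    | zero => exact ⟨∅, by simp, by simp, by simp⟩
    | succ t ih =>
      obtain ⟨B, hBA, hBt, hB⟩ := ih
      set Q := P.filter fun p => ∀ b ∈ B, b ∉ S p with hQ
      have hcount : ∑ a ∈ A, (Q.card * N : ℝ) / A.card ≤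
          ∑ a ∈ A, ((Q.filter fun p => a ∈ S p).card : ℝ) := by
        have h1 : ∑ a ∈ A, (Q.filter fun p => a ∈ S p).card = ∑ p ∈ Q, (S p).card := by
          simp_rw [Finset.card_filter]
          rw [Finset.sum_comm]
          refine Finset.sum_congr rfl fun p hp => ?_
          rw [← Finset.card_filter, Finset.filter_mem_eq_inter,
            Finset.inter_eq_right.2 (hS p (Finset.mem_filter.1 hp).1)]
        have h2 : Q.card * N ≤ ∑ p ∈ Q, (S p).card := by
          rw [← smul_eq_mul]
          exact Finset.card_nsmul_le_sum _ _ _ fun p hp => hN p (Finset.mem_filter.1 hp).1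
        rw [Finset.sum_const, nsmul_eq_mul, mul_div_cancel₀ _ hA0.ne', ← Nat.cast_sum, h1]
        exact_mod_cast h2
      obtain ⟨a, haA, ha⟩ := Finset.exists_le_of_sum_le hA hcount
      refine ⟨insert a B, Finset.insert_subset haA hBA,
        (Finset.card_insert_le _ _).trans (by omega), ?_⟩
      have hsplit : ((P.filter fun p => ∀ b ∈ insert a B, b ∉ S p).card : ℝ) =
          Q.card - (Q.filter fun p => a ∈ S p).card := by
        have h1 : (P.filter fun p => ∀ b ∈ insert a B, b ∉ S p) =
            Q.filter fun p => a ∉ S p := by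
          ext p
          simp only [hQ, Finset.mem_filter, Finset.forall_mem_insert]
          tauto
        rw [h1, ← Finset.card_filter_add_card_filter_not (s := Q) (fun p => a ∈ S p)]
        push_cast
        ring
      have hexp := Real.add_one_le_exp (-((N : ℝ) / A.card))
      calc _ = (Q.card : ℝ) - (Q.filter fun p => a ∈ S p).card := hsplit
        _ ≤ Q.card - (Q.card * N : ℝ) / A.card := by linarith
        _ = Q.card * (-(N / A.card) + 1) := by ring
        _ ≤ Q.card * Real.exp (-(N / A.card)) := by gcongr
        _ ≤ P.card * Real.exp (-(N / A.card) * t) * Real.exp (-(N / A.card)) := by gcongr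
        _ = P.card * Real.exp (-(N / A.card) * ↑(t + 1)) := by
          rw [mul_assoc, ← Real.exp_add]
          push_cast
          ring_nf
  obtain ⟨B, hBA, hBt, hB⟩ := greedy ⌈ε * A.card⌉₊
  refine ⟨B, hBA, ?_, ?_⟩
  · have := Nat.ceil_lt_add_one (by positivity : 0 ≤ ε * A.card)
    have : (B.card : ℝ) ≤ ⌈ε * A.card⌉₊ := by exact_mod_cast hBt
    linarith
  · have hlt : ((P.filter fun p => ∀ b ∈ B, b ∉ S p).card : ℝ) < 1 := by
      have h1 : ε * N ≤ N / A.card * ⌈ε * A.card⌉₊ := by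
        calc ε * N = N / A.card * (ε * A.card) := by field_simp
          _ ≤ _ := by gcongr; exact Nat.le_ceil _
      calc _ ≤ _ := hB
        _ ≤ P.card * Real.exp (-(ε * N)) := by
          gcongr
          linarith
        _ < Real.exp (ε * N) * Real.exp (-(ε * N)) := by gcongr
        _ = 1 := by rw [← Real.exp_add]; simp
    have h0 : (P.filter fun p => ∀ b ∈ B, b ∉ S p) = ∅ := by
      rw [← Finset.card_eq_zero]
      have : (P.filter fun p => ∀ b ∈ B, b ∉ S p).card < 1 := by exact_mod_cast hlt
      omega
    intro p hp
    by_contra! h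
    have : p ∈ P.filter fun p => ∀ b ∈ B, b ∉ S p := Finset.mem_filter.2 ⟨hp, h⟩
    simp [h0] at this

section Net

variable {V : Type*} [NormedAddCommGroup V] [NormedSpace ℝ V] [FiniteDimensional ℝ V]

open Module Metric in
/-- The volume bound for the cardinality of a `δ`-separated set in a ball. -/
lemma card_mul_pow_le_of_separated {R δ : ℝ} (hR : 0 ≤ R) (hδ : 0 < δ) (hδ1 : δ ≤ 1)
    (s : Finset V) (hs : ∀ c ∈ s, ‖c‖ ≤ R) (h : ∀ c ∈ s, ∀ d ∈ s, c ≠ d → δ ≤ ‖c - d‖) :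
    s.card * δ ^ finrank ℝ V ≤ (2 * (R + 1)) ^ finrank ℝ V := by
  borelize V
  let μ : Measure V := Measure.addHaar
  have hδ2 : 0 < δ / 2 := by positivity
  have hR1 : 0 < R + 1 := by positivity
  have D : Set.Pairwise (s : Set V) (Function.onFun Disjoint fun c => ball (c : V) (δ / 2)) := by
    rintro c hc d hd hcd
    apply ball_disjoint_ball
    rw [dist_eq_norm]
    linarith [h c hc d hd hcd]
  have hsub : ⋃ c ∈ s, ball (c : V) (δ / 2) ⊆ ball (0 : V) (R + 1) := by
    refine iUnion₂_subset fun x hx => ?_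
    apply ball_subset_ball'
    rw [dist_zero_right]
    linarith [hs x hx]
  have I : (s.card : ENNReal) * ENNReal.ofReal ((δ / 2) ^ finrank ℝ V) * μ (ball 0 1) ≤
      ENNReal.ofReal ((R + 1) ^ finrank ℝ V) * μ (ball 0 1) := by
    rw [← μ.addHaar_ball_of_pos (0 : V) hR1]
    refine le_trans (le_of_eq ?_) (measure_mono hsub)
    rw [measure_biUnion_finset D fun c _ => measurableSet_ball]
    simp only [μ.addHaar_ball_of_pos _ hδ2, Finset.sum_const, nsmul_eq_mul, mul_assoc]
  have J : (s.card : ENNReal) * ENNReal.ofReal ((δ / 2) ^ finrank ℝ V) ≤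
      ENNReal.ofReal ((R + 1) ^ finrank ℝ V) :=
    (ENNReal.mul_le_mul_iff_left (measure_ball_pos _ _ zero_lt_one).ne'
      measure_ball_lt_top.ne).1 I
  have K := ENNReal.toReal_le_of_le_ofReal (by positivity) J
  rw [ENNReal.toReal_mul, ENNReal.toReal_natCast, ENNReal.toReal_ofReal (by positivity)] at K
  calc s.card * δ ^ finrank ℝ V = 2 ^ finrank ℝ V * (s.card * (δ / 2) ^ finrank ℝ V) := by
        rw [mul_left_comm, ← mul_pow]
        congr 2
        ring
    _ ≤ 2 ^ finrank ℝ V * (R + 1) ^ finrank ℝ V := by gcongr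
    _ = _ := by rw [mul_pow]

open Module in
/-- Every subset of a ball has a `δ`-net with `O(δ ^ (-dim))` elements. -/
lemma exists_net {R δ : ℝ} (hR : 0 ≤ R) (hδ : 0 < δ) (hδ1 : δ ≤ 1)
    (G : Set V) (hG : ∀ c ∈ G, ‖c‖ ≤ R) :
    ∃ s : Finset V, (∀ c ∈ s, c ∈ G) ∧ (∀ v ∈ G, ∃ c ∈ s, ‖v - c‖ ≤ δ) ∧
      s.card * δ ^ finrank ℝ V ≤ (2 * (R + 1)) ^ finrank ℝ V := by
  classical
  let F : Set ℕ := {k | ∃ s : Finset V, (∀ c ∈ s, c ∈ G) ∧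
    (∀ c ∈ s, ∀ d ∈ s, c ≠ d → δ ≤ ‖c - d‖) ∧ s.card = k}
  have hne : F.Nonempty := ⟨0, ∅, by simp⟩
  have hbdd : BddAbove F := by
    refine ⟨⌊(2 * (R + 1)) ^ finrank ℝ V / δ ^ finrank ℝ V⌋₊, ?_⟩
    rintro k ⟨s, hs, hsep, rfl⟩
    apply Nat.le_floor
    rw [le_div_iff₀ (by positivity)]
    exact card_mul_pow_le_of_separated hR hδ hδ1 s (fun c hc => hG c (hs c hc)) hsep
  obtain ⟨s, hs, hsep, hcard⟩ := Nat.sSup_mem hne hbdd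
  refine ⟨s, hs, fun v hv => ?_,
    card_mul_pow_le_of_separated hR hδ hδ1 s (fun c hc => hG c (hs c hc)) hsep⟩
  by_contra! hfar
  have hvs : v ∉ s := fun h => by
    have := hfar v h
    simp only [sub_self, norm_zero] at this
    linarith
  have : s.card + 1 ∈ F := by
    refine ⟨insert v s, ?_, ?_, Finset.card_insert_of_notMem hvs⟩
    · simpa using ⟨hv, hs⟩
    · intro c hc d hd hcd
      rcases Finset.mem_insert.1 hc with rfl | hcs <;>
        rcases Finset.mem_insert.1 hd with rfl | hds
      · exact absurd rfl hcd
      · exact (hfar d hds).le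
      · rw [norm_sub_rev]
        exact (hfar c hcs).le
      · exact hsep c hcs d hds hcd
  have := le_csSup hbdd this
  omega

end Net

open Module Metric in
/-- An open set of small measure meeting all affine copies `T x + v` of the sequence for which
`T`, its inverse and `v` are bounded by `R`. -/
lemma exists_isOpen_meets_affine_copies {E : Type*} [NormedAddCommGroup E] [NormedSpace ℝ E]
    [FiniteDimensional ℝ E] [MeasurableSpace E] [BorelSpace E] (μ : Measure E)
    [μ.IsAddHaarMeasure] (hdim : finrank ℝ E ≠ 0) {x : ℕ → E} (hne : ∀ n, x n ≠ 0)
    (hnorm : Tendsto (fun n => ‖x n‖) atTop (nhds 0))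
    (hratio : Tendsto (fun n => ‖x (n + 1)‖ / ‖x n‖) atTop (nhds 1))
    {R ε : ℝ} (hR : 1 ≤ R) (hε : 0 < ε) :
    ∃ U : Set E, IsOpen U ∧ μ U ≤ ENNReal.ofReal ε ∧
      ∀ (T : E →L[ℝ] E) (v : E), ‖T‖ ≤ R → ‖v‖ ≤ R → (∀ z, ‖z‖ ≤ R * ‖T z‖) →
        ∃ n, T (x n) + v ∈ U := by
  classical
  have hR0 : 0 < R := by linarith
  set d := finrank ℝ E with hd
  set D := finrank ℝ ((E →L[ℝ] E) × E) with hD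
  set C₁ : ℝ := (2 * (2 * R + 1)) ^ d with hC₁
  set C₂ : ℝ := (2 * (R + 1)) ^ D with hC₂
  have hC₁0 : 0 < C₁ := by positivity
  have hC₂0 : 0 < C₂ := by positivity
  set K : ℝ := (μ (ball 0 1)).toReal with hK
  have hK0 : 0 ≤ K := ENNReal.toReal_nonneg
  have hμK : μ (ball 0 1) = ENNReal.ofReal K :=
    (ENNReal.ofReal_toReal measure_ball_lt_top.ne).symm
  obtain ⟨κ, hκ0, hκ⟩ : ∃ κ : ℝ, 0 < κ ∧ 4 ^ d * K * (κ * (C₁ + 1)) ≤ ε := by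
    refine ⟨ε / (4 ^ d * (K + 1) * (C₁ + 1)), by positivity, ?_⟩
    calc 4 ^ d * K * (ε / (4 ^ d * (K + 1) * (C₁ + 1)) * (C₁ + 1)) = ε * (K / (K + 1)) := by
          field_simp
      _ ≤ ε * 1 := by
          gcongr
          rw [div_le_one (by positivity)]
          linarith
      _ = ε := mul_one ε
  set b : ℝ := κ / (4 * D + 4) with hb
  have hb0 : 0 < b := by positivity
  have hbD : 4 * b * D ≤ κ := by
    have : b * (4 * D + 4) = κ := by rw [hb]; field_simp
    linarith
  set q : ℝ := Real.exp (-b) with hq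
  have hq0 : 0 < q := Real.exp_pos _
  have hq1 : q < 1 := Real.exp_lt_one_iff.2 (by linarith)
  obtain ⟨r, hr0, hr1, m, hm⟩ :=
    exists_geometric_selection (fun n => norm_pos_iff.2 (hne n)) hnorm hratio hq0 hq1
  have hx1 (i : ℕ) : ‖x (m i)‖ ≤ 1 :=
    (hm i).2.trans (mul_le_one₀ (pow_le_one₀ hq0.le hq1.le) hr0.le hr1)
  set c : ℝ := (1 - q) * r / (4 * R) with hc
  have hc0 : 0 < c := div_pos (mul_pos (by linarith) hr0) (by positivity)
  have hc1 : c ≤ 1 := by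
    rw [hc, div_le_one (by positivity)]
    nlinarith
  obtain ⟨N, hN₁, hN₂⟩ : ∃ N : ℕ, C₂ / c ^ D < Real.exp (κ / 2 * N) ∧ q ^ (2 * N) ≤ κ := by
    have h₁ : Tendsto (fun N : ℕ => Real.exp (κ / 2 * N)) atTop atTop :=
      Real.tendsto_exp_atTop.comp
        (tendsto_natCast_atTop_atTop.const_mul_atTop (by positivity : 0 < κ / 2))
    have h₂ : Tendsto (fun N : ℕ => q ^ (2 * N)) atTop (nhds 0) := by
      simp_rw [pow_mul]
      exact tendsto_pow_atTop_nhds_zero_of_lt_one (by positivity)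
        (pow_lt_one₀ hq0.le hq1 two_ne_zero)
    exact ((h₁.eventually_gt_atTop _).and (h₂.eventually (eventually_le_nhds hκ0))).exists
  set δ : ℝ := q ^ (2 * N) * c with hδ
  have hδ0 : 0 < δ := by positivity
  have hδ1 : δ ≤ 1 := mul_le_one₀ (pow_le_one₀ hq0.le hq1.le) hc0.le hc1
  have hδκ : δ ^ d ≤ κ :=
    (pow_le_of_le_one hδ0.le hδ1 hdim).trans
      ((mul_le_of_le_one_right (by positivity) hc1).trans hN₂)
  -- the nets of points and of parameters
  obtain ⟨A, -, hAnet, hAcard⟩ := exists_net (by positivity : 0 ≤ 2 * R) hδ0 hδ1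
    (closedBall (0 : E) (2 * R)) (fun c hc => by simpa using hc)
  obtain ⟨P, hPG, hPnet, hPcard⟩ := exists_net hR0.le hδ0 hδ1
    {p : (E →L[ℝ] E) × E | ‖p.1‖ ≤ R ∧ ‖p.2‖ ≤ R ∧ ∀ z, ‖z‖ ≤ R * ‖p.1 z‖}
    (fun p hp => norm_prod_le_iff.2 ⟨hp.1, hp.2.1⟩)
  have hg (y : E) : ∃ a, ‖y‖ ≤ 2 * R → a ∈ A ∧ ‖y - a‖ ≤ δ := by
    by_cases hy : ‖y‖ ≤ 2 * R
    · obtain ⟨a, ha⟩ := hAnet y (by simpa using hy)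
      exact ⟨a, fun _ => ha⟩
    · exact ⟨0, fun h => absurd h hy⟩
  choose g hg using hg
  have hbound (p : (E →L[ℝ] E) × E) (hp : p ∈ P) (i : ℕ) :
      ‖p.1 (x (m i)) + p.2‖ ≤ 2 * R := by
    obtain ⟨h1, h2, -⟩ := hPG p hp
    calc _ ≤ ‖p.1 (x (m i))‖ + ‖p.2‖ := norm_add_le _ _
      _ ≤ R * 1 + R := add_le_add (p.1.le_of_opNorm_le_of_le h1 (hx1 i)) h2
      _ = 2 * R := by ring
  let S (p : (E →L[ℝ] E) × E) : Finset E :=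
    (Finset.range N).image fun i => g (p.1 (x (m i)) + p.2)
  have hSA (p) (hp : p ∈ P) : S p ⊆ A := by
    intro a ha
    obtain ⟨i, -, rfl⟩ := Finset.mem_image.1 ha
    exact (hg _ (hbound p hp i)).1
  have hsep (p) (hp : p ∈ P) (i j : ℕ) (hij : i < j) (hj : j < N) :
      g (p.1 (x (m i)) + p.2) ≠ g (p.1 (x (m j)) + p.2) := by
    intro heq
    have hgi := (hg _ (hbound p hp i)).2
    have hgj := (hg _ (hbound p hp j)).2
    rw [← heq] at hgj
    have h1 : ‖p.1 (x (m i) - x (m j))‖ ≤ 2 * δ := by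
      calc _ = ‖(p.1 (x (m i)) + p.2 - g (p.1 (x (m i)) + p.2)) -
            (p.1 (x (m j)) + p.2 - g (p.1 (x (m i)) + p.2))‖ := by
            rw [map_sub]
            congr 1
            abel
        _ ≤ δ + δ := (norm_sub_le _ _).trans (add_le_add hgi hgj)
        _ = 2 * δ := by ring
    have h2 : ‖x (m i)‖ - ‖x (m j)‖ ≤ R * (2 * δ) :=
      (norm_sub_norm_le _ _).trans (((hPG p hp).2.2 _).trans (by gcongr))
    have h3 : ‖x (m j)‖ ≤ q ^ (2 * i + 2) * r := (hm j).2.trans <| by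
      gcongr ?_ * r
      exact pow_le_pow_of_le_one hq0.le hq1.le (by omega)
    have h4 : q ^ (2 * N) ≤ q ^ (2 * i + 1) := pow_le_pow_of_le_one hq0.le hq1.le (by omega)
    have h5 : R * (4 * δ) = q ^ (2 * N) * ((1 - q) * r) := by
      rw [hδ, hc]
      field_simp
    have h6 : q ^ (2 * N) * ((1 - q) * r) ≤ q ^ (2 * i + 1) * ((1 - q) * r) := by
      have : 0 < 1 - q := by linarith
      gcongr
    have h7 : q ^ (2 * i + 2) = q ^ (2 * i + 1) * q := pow_succ _ _
    have h8 := (hm i).1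
    have h9 : 0 < R * δ := by positivity
    rw [h7] at h3
    linarith
  have hScard (p) (hp : p ∈ P) : N ≤ (S p).card := by
    rw [Finset.card_image_of_injOn, Finset.card_range]
    intro i hi j hj hij
    rcases lt_trichotomy i j with h | h | h
    · exact absurd hij (hsep p hp i j h (by simpa using hj))
    · exact h
    · exact absurd hij.symm (hsep p hp j i h (by simpa using hi))
  have hPexp : (P.card : ℝ) < Real.exp (κ * N) := by
    have hqD : Real.exp (-(κ / 2 * N)) ≤ (q ^ (2 * N)) ^ D := by
      rw [hq, ← Real.exp_nat_mul, ← Real.exp_nat_mul, Real.exp_le_exp]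
      push_cast
      nlinarith [(Nat.cast_nonneg N : (0 : ℝ) ≤ N)]
    have hlow : Real.exp (-(κ / 2 * N)) * c ^ D ≤ δ ^ D := by
      rw [hδ, mul_pow]
      gcongr
    have h1 : P.card * (Real.exp (-(κ / 2 * N)) * c ^ D) ≤ C₂ :=
      (mul_le_mul_of_nonneg_left hlow (Nat.cast_nonneg _)).trans hPcard
    calc (P.card : ℝ) =
        P.card * (Real.exp (-(κ / 2 * N)) * c ^ D) / c ^ D * Real.exp (κ / 2 * N) := by
          rw [← mul_assoc, mul_div_assoc, div_self (pow_pos hc0 D).ne', mul_one, mul_assoc,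
            ← Real.exp_add, neg_add_cancel, Real.exp_zero, mul_one]
      _ ≤ C₂ / c ^ D * Real.exp (κ / 2 * N) := by gcongr
      _ < Real.exp (κ / 2 * N) * Real.exp (κ / 2 * N) := by gcongr
      _ = Real.exp (κ * N) := by
          rw [← Real.exp_add]
          ring_nf
  obtain ⟨B, -, hBcard, hB⟩ := exists_small_hitting_set A P S hSA hScard hκ0.le hPexp
  refine ⟨⋃ a ∈ B, ball a (4 * δ), isOpen_biUnion fun _ _ => isOpen_ball, ?_, ?_⟩
  · calc μ (⋃ a ∈ B, ball a (4 * δ)) ≤ ∑ a ∈ B, μ (ball a (4 * δ)) :=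
          measure_biUnion_finset_le _ _
      _ = ENNReal.ofReal (B.card * ((4 * δ) ^ d * K)) := by
          simp only [μ.addHaar_ball_of_pos _ (by positivity : 0 < 4 * δ), hμK,
            Finset.sum_const, nsmul_eq_mul]
          rw [ENNReal.ofReal_mul (Nat.cast_nonneg _), ENNReal.ofReal_mul (by positivity),
            ENNReal.ofReal_natCast]
      _ ≤ ENNReal.ofReal ε := by
          apply ENNReal.ofReal_le_ofReal
          calc B.card * ((4 * δ) ^ d * K) ≤ (κ * A.card + 1) * ((4 * δ) ^ d * K) := by gcongr
            _ = 4 ^ d * K * (κ * (A.card * δ ^ d) + δ ^ d) := by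
              rw [mul_pow]
              ring
            _ ≤ 4 ^ d * K * (κ * C₁ + κ) := by gcongr
            _ = 4 ^ d * K * (κ * (C₁ + 1)) := by ring
            _ ≤ ε := hκ
  · intro T v hT hv hTinv
    obtain ⟨p, hp, hpd⟩ := hPnet (T, v) ⟨hT, hv, hTinv⟩
    obtain ⟨hp1, hp2⟩ := norm_prod_le_iff.1 hpd
    obtain ⟨a, haB, haS⟩ := hB p hp
    obtain ⟨i, -, rfl⟩ := Finset.mem_image.1 haS
    refine ⟨m i, mem_iUnion₂.2 ⟨_, haB, ?_⟩⟩
    have h1 := (hg _ (hbound p hp i)).2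
    rw [mem_ball, dist_eq_norm]
    calc _ = ‖(T - p.1) (x (m i)) + (v - p.2) +
          (p.1 (x (m i)) + p.2 - g (p.1 (x (m i)) + p.2))‖ := by
          rw [sub_apply]
          congr 1
          abel
      _ ≤ δ * 1 + δ + δ :=
          norm_add₃_le.trans (add_le_add (add_le_add
            ((T - p.1).le_of_opNorm_le_of_le hp1 (hx1 i)) hp2) h1)
      _ < 4 * δ := by linarith

lemma isClosed_unitCube (d : ℕ) : IsClosed (unitCube d) := by
  simp only [unitCube, ofPred_forall]
  exact isClosed_iInter fun i => isClosed_Icc.preimage (by fun_prop)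

lemma volume_unitCube_pos (d : ℕ) : 0 < volume (unitCube d) := by
  refine (Metric.measure_ball_pos volume (WithLp.toLp 2 fun _ => (1 / 2 : ℝ)) one_half_pos).trans_le
    (measure_mono fun y hy i => ?_)
  rw [Metric.mem_ball, dist_eq_norm] at hy
  have h := (PiLp.norm_apply_le _ i).trans hy.le
  rw [PiLp.sub_apply, Real.norm_eq_abs, abs_le] at h
  constructor <;> linarith [h.1, h.2]

/-- **Generalized Eigen–Falconer theorem.**
If `A = {x_n}` is a sequence of nonzero vectors in `ℝ^d` with `‖x_n‖ → 0` and
`‖x_{n+1}‖/‖x_n‖ → 1`, then there is a closed set `E ⊆ [0,1]^d` of positive Lebesgue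
measure containing no affine copy of `A`. -/
theorem stmt0 (d : ℕ) (hd : 1 ≤ d) (x : ℕ → EuclideanSpace ℝ (Fin d))
    (hne : ∀ n, x n ≠ 0)
    (hnorm : Tendsto (fun n => ‖x n‖) atTop (nhds 0))
    (hratio : Tendsto (fun n => ‖x (n + 1)‖ / ‖x n‖) atTop (nhds 1)) :
    ∃ E : Set (EuclideanSpace ℝ (Fin d)), IsClosed E ∧ E ⊆ unitCube d ∧
      0 < volume E ∧
      ∀ (T : EuclideanSpace ℝ (Fin d) ≃ₗ[ℝ] EuclideanSpace ℝ (Fin d))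
        (v : EuclideanSpace ℝ (Fin d)),
        ¬ ((fun a => T a + v) '' Set.range x ⊆ E) := by
  obtain ⟨ε, hε0, hεsum⟩ :=
    ENNReal.exists_pos_sum_of_countable (volume_unitCube_pos d).ne' ℕ
  have hU (k : ℕ) := exists_isOpen_meets_affine_copies
    (volume : Measure (EuclideanSpace ℝ (Fin d))) (by simp; omega) hne hnorm hratio
    (R := k + 1) (ε := ε k) (by simp) (hε0 k)
  choose U hUo hUμ hU using hU
  refine ⟨unitCube d \ ⋃ k, U k, ?_, sdiff_subset, ?_, ?_⟩
  · exact (isClosed_unitCube d).sdiff (isOpen_iUnion hUo)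
  · have hlt : volume (⋃ k, U k) < volume (unitCube d) := by
      refine lt_of_le_of_lt ((measure_iUnion_le _).trans (ENNReal.tsum_le_tsum fun k => ?_)) hεsum
      simpa using hUμ k
    exact (tsub_pos_iff_lt.2 hlt).trans_le le_measure_sdiff
  · intro T v hsub
    let L := T.toContinuousLinearEquiv
    obtain ⟨k, hk⟩ := exists_nat_ge
      (max ‖(L : EuclideanSpace ℝ (Fin d) →L[ℝ] EuclideanSpace ℝ (Fin d))‖ (max ‖v‖
        ‖(L.symm : EuclideanSpace ℝ (Fin d) →L[ℝ] EuclideanSpace ℝ (Fin d))‖))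
    simp only [max_le_iff] at hk
    obtain ⟨n, hn⟩ := hU k L v (by linarith) (by linarith) fun z => by
      have := (L.symm : EuclideanSpace ℝ (Fin d) →L[ℝ] EuclideanSpace ℝ (Fin d)).le_of_opNorm_le
        (show _ ≤ (k : ℝ) + 1 by linarith) (L z)
      simpa using this
    exact (hsub ⟨x n, mem_range_self n, rfl⟩).2 (mem_iUnion.2 ⟨k, hn⟩)
end

section
/- Let d ≥ 1 and let A ⊆ ℝ^d be a bounded infinite set. Suppose there exists a sequence {A_n}_{n=1}^∞ of finite subsets of A, each with at least two elements, such that #A_n → ∞ and (−log δ(A_n))/#A_n → 0 as n → ∞. Then there exists a closed set E ⊆ [0,1]^d with μ(E) > 0 such that E contains no affine copy of A, i.e., for every invertible linear map T : ℝ^d → ℝ^d and every x ∈ ℝ^d, TA + x is not contained in E. -/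
open MeasureTheory Filter Set

/-- The quantity `δ(F) = min{‖x−y‖ : x ≠ y ∈ F} / max{‖z‖ : z ∈ F}` for a finite set
`F ⊆ ℝ^d` with at least two elements. -/
noncomputable def delta {d : ℕ} (F : Set (EuclideanSpace ℝ (Fin d))) : ℝ :=
  sInf {s : ℝ | ∃ x ∈ F, ∃ y ∈ F, x ≠ y ∧ ‖x - y‖ = s} /
    sSup {s : ℝ | ∃ z ∈ F, ‖z‖ = s}

/-- Greedy bound for hitting sets: a nonempty family of subsets of `G`, each with at least `N`
elements, is hit by a set of at most `#G * (log (size of the family) + 1) / N` points. -/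
lemma exists_hitting_finset {ι α : Type*} [DecidableEq α] (G : Finset α) (K : Finset ι)
    (F : ι → Finset α) (N : ℕ) (hN : 0 < N) (hK : K.Nonempty)
    (hF : ∀ i ∈ K, F i ⊆ G ∧ N ≤ (F i).card) :
    ∃ S : Finset α, (S.card : ℝ) * N ≤ G.card * (Real.log K.card + 1) ∧
      ∀ i ∈ K, ∃ a ∈ F i, a ∈ S := by
  classical
  obtain ⟨i₀, hi₀⟩ := hK
  have hNG : N ≤ G.card := (hF i₀ hi₀).2.trans (Finset.card_le_card (hF i₀ hi₀).1)
  have hN' : (0 : ℝ) < N := by exact_mod_cast hN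
  have hNG' : (N : ℝ) ≤ G.card := by exact_mod_cast hNG
  have hG : (0 : ℝ) < G.card := hN'.trans_le hNG'
  have hKpos : (0 : ℝ) < K.card := by exact_mod_cast Finset.card_pos.2 ⟨i₀, hi₀⟩
  have greedy : ∀ t : ℕ, ∃ S : Finset α, S.card ≤ t ∧
      ((K.filter fun i => Disjoint (F i) S).card : ℝ) ≤ K.card * (1 - N / G.card) ^ t := by
    intro t
    induction t with
    | zero => exact ⟨∅, by simp, by simp⟩
    | succ t ih =>
      obtain ⟨S, hSt, hS⟩ := ih
      set L := K.filter fun i => Disjoint (F i) S with hL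
      have hsum : (L.card : ℝ) * N ≤ ∑ a ∈ G, ((L.filter fun i => a ∈ F i).card : ℝ) := by
        have h1 := Finset.sum_card_bipartiteAbove_eq_sum_card_bipartiteBelow
          (s := G) (t := L) (fun a i => a ∈ F i)
        simp only [Finset.bipartiteAbove, Finset.bipartiteBelow] at h1
        have h2 : L.card * N ≤ ∑ i ∈ L, (G.filter fun a => a ∈ F i).card := by
          rw [← smul_eq_mul]
          refine Finset.card_nsmul_le_sum _ _ _ fun i hi => ?_
          have hi' := hF i (Finset.mem_filter.1 hi).1
          rw [Finset.filter_mem_eq_inter, Finset.inter_eq_right.2 hi'.1]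
          exact hi'.2
        rw [← h1] at h2
        exact_mod_cast h2
      obtain ⟨a, -, ha⟩ : ∃ a ∈ G, (L.card : ℝ) * N / G.card ≤
          ((L.filter fun i => a ∈ F i).card : ℝ) := by
        by_contra! hcon
        have := Finset.sum_lt_sum_of_nonempty
          (Finset.card_pos.1 (by exact_mod_cast hG)) hcon
        rw [Finset.sum_const, nsmul_eq_mul, mul_div_cancel₀ _ hG.ne'] at this
        linarith
      refine ⟨insert a S, (Finset.card_insert_le _ _).trans (by omega), ?_⟩
      have hsub : (K.filter fun i => Disjoint (F i) (insert a S)) ⊆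
          L.filter fun i => a ∉ F i := by
        intro i hi
        simp only [Finset.mem_filter, Finset.disjoint_insert_right, hL] at hi ⊢
        tauto
      have hcard := Finset.card_filter_add_card_filter_not (s := L) (fun i => a ∈ F i)
      have h3 : (((L.filter fun i => a ∈ F i).card : ℝ)) +
          ((L.filter fun i => a ∉ F i).card : ℝ) = L.card := by exact_mod_cast hcard
      have h4 : ((K.filter fun i => Disjoint (F i) (insert a S)).card : ℝ) ≤
          ((L.filter fun i => a ∉ F i).card : ℝ) := by
        exact_mod_cast Finset.card_le_card hsub
      have h5 : (0 : ℝ) ≤ 1 - N / G.card := by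
        rw [sub_nonneg, div_le_one hG]; exact hNG'
      calc _ ≤ (L.card : ℝ) - L.card * N / G.card := by linarith
        _ = L.card * (1 - N / G.card) := by ring
        _ ≤ (K.card * (1 - N / G.card) ^ t) * (1 - N / G.card) := by gcongr
        _ = _ := by ring
  have hlog : 0 ≤ Real.log K.card := Real.log_natCast_nonneg _
  set t := ⌊G.card * Real.log K.card / N⌋₊ + 1 with ht
  obtain ⟨S, hSt, hS⟩ := greedy t
  have htl : G.card * Real.log K.card / N < (t : ℝ) := by
    rw [ht]; push_cast; exact Nat.lt_floor_add_one _
  have htu : (t : ℝ) ≤ G.card * Real.log K.card / N + 1 := by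
    rw [ht]; push_cast
    have := Nat.floor_le (a := G.card * Real.log K.card / N) (by positivity)
    linarith
  have hlt : (K.card : ℝ) * (1 - N / G.card) ^ t < 1 := by
    have h1 : (1 - (N : ℝ) / G.card) ^ t ≤ Real.exp (-(N / G.card) * t) := by
      rw [mul_comm, Real.exp_nat_mul]
      refine pow_le_pow_left₀ ?_ ?_ _
      · rw [sub_nonneg, div_le_one hG]; exact hNG'
      · have := Real.add_one_le_exp (-((N : ℝ) / G.card))
        linarith
    have h2 : Real.log K.card < N / G.card * t := by
      rw [div_lt_iff₀ hN'] at htl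
      rw [div_mul_eq_mul_div, lt_div_iff₀ hG]
      linarith
    calc (K.card : ℝ) * (1 - N / G.card) ^ t
        ≤ Real.exp (Real.log K.card) * Real.exp (-(N / G.card) * t) := by
          rw [Real.exp_log hKpos]; gcongr
      _ = Real.exp (Real.log K.card - N / G.card * t) := by rw [← Real.exp_add]; ring_nf
      _ < 1 := by rw [Real.exp_lt_one_iff]; linarith
  refine ⟨S, ?_, fun i hi => ?_⟩
  · have h1 : (S.card : ℝ) ≤ t := by exact_mod_cast hSt
    calc (S.card : ℝ) * N ≤ (G.card * Real.log K.card / N + 1) * N := by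
          gcongr; exact h1.trans htu
      _ = G.card * Real.log K.card + N := by field_simp
      _ ≤ _ := by linarith
  · by_contra! hcon
    have hmem : i ∈ K.filter fun i => Disjoint (F i) S := by
      rw [Finset.mem_filter, Finset.disjoint_left]
      exact ⟨hi, hcon⟩
    have : (1 : ℝ) ≤ (K.filter fun i => Disjoint (F i) S).card := by
      exact_mod_cast Finset.card_pos.2 ⟨i, hmem⟩
    linarith

lemma volume_setOf_mem_Ioo {d : ℕ} (a b : Fin d → ℝ) :
    volume {p : EuclideanSpace ℝ (Fin d) | ∀ i, p i ∈ Ioo (a i) (b i)} =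
      ∏ i, ENNReal.ofReal (b i - a i) := by
  have h := (EuclideanSpace.volume_preserving_symm_measurableEquiv_toLp (Fin d)).measure_preimage
    (MeasurableSet.univ_pi fun i => measurableSet_Ioo (a := a i) (b := b i)).nullMeasurableSet
  rw [← Real.volume_pi_Ioo, ← h]
  congr 1
  ext p
  simp [Set.mem_pi]

lemma volume_unitCube (d : ℕ) : volume (unitCube d) = 1 := by
  have h := Real.volume_Icc_pi (a := fun _ : Fin d => (0 : ℝ)) (b := fun _ => 1)
  simp only [sub_zero, ENNReal.ofReal_one, Finset.prod_const_one] at h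
  have h' := (EuclideanSpace.volume_preserving_symm_measurableEquiv_toLp (Fin d)).measure_preimage
    (measurableSet_Icc (a := fun _ => (0 : ℝ)) (b := fun _ => 1)).nullMeasurableSet
  rw [← h, ← h']
  congr 1
  ext p
  simp [unitCube, Pi.le_def, forall_and]

/-- The cell, modulo `m` in each coordinate, containing `p` in the grid of mesh `h`. -/
noncomputable def gridCell {d : ℕ} (h : ℝ) (m : ℕ) (p : EuclideanSpace ℝ (Fin d)) :
    Fin d → ℤ :=
  fun i => ⌊p i / h⌋ % (m : ℤ)

/-- The union of the enlarged open cells of the grid of mesh `h` whose index modulo `m`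
belongs to `S`. -/
def periodicBoxes {d : ℕ} (h : ℝ) (m : ℕ) (S : Finset (Fin d → ℤ)) :
    Set (EuclideanSpace ℝ (Fin d)) :=
  {p | ∃ z : Fin d → ℤ, (fun i => z i % (m : ℤ)) ∈ S ∧
    ∀ i, p i ∈ Ioo (h * (z i - 1)) (h * (z i + 2))}

lemma isOpen_periodicBoxes {d : ℕ} (h : ℝ) (m : ℕ) (S : Finset (Fin d → ℤ)) :
    IsOpen (periodicBoxes h m S) := by
  have : periodicBoxes h m S = ⋃ z : Fin d → ℤ, ⋃ _ : (fun i => z i % (m : ℤ)) ∈ S,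
      ⋂ i, {p : EuclideanSpace ℝ (Fin d) | p i ∈ Ioo (h * (z i - 1)) (h * (z i + 2))} := by
    ext; simp [periodicBoxes]
  rw [this]
  exact isOpen_iUnion fun z => isOpen_iUnion fun _ =>
    isOpen_iInter_of_finite fun i => isOpen_Ioo.preimage (by fun_prop)

lemma volume_periodicBoxes_inter_le {d : ℕ} {h : ℝ} (hh : 0 < h) {m : ℕ} (hm : 0 < m)
    (S : Finset (Fin d → ℤ)) :
    volume (periodicBoxes h m S ∩ unitCube d) ≤
      ENNReal.ofReal (S.card * (((1 / h + 1) / m + 2) ^ d * (3 * h) ^ d)) := by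
  have hm' : (0 : ℝ) < m := by exact_mod_cast hm
  set J : Finset ℤ := Finset.Icc (-1) ⌊(1 / h + 1) / m⌋ with hJ
  have hJcard : (J.card : ℝ) ≤ (1 / h + 1) / m + 2 := by
    rw [hJ, Int.card_Icc]
    have h0 : (0 : ℤ) ≤ ⌊(1 / h + 1) / m⌋ := Int.floor_nonneg.2 (by positivity)
    have h1 := Int.floor_le ((1 / h + 1) / (m : ℝ))
    have h2 : (((⌊(1 / h + 1) / (m : ℝ)⌋ + 1 - -1).toNat : ℤ) : ℝ) =
        ((⌊(1 / h + 1) / (m : ℝ)⌋ + 1 - -1 : ℤ) : ℝ) := by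
      rw [Int.toNat_of_nonneg (by omega)]
    push_cast at h2
    linarith
  set B : (Fin d → ℤ) × (Fin d → ℤ) → Set (EuclideanSpace ℝ (Fin d)) := fun w =>
    {p | ∀ i, p i ∈ Ioo (h * (((w.1 i + m * w.2 i : ℤ) : ℝ) - 1))
      (h * (((w.1 i + m * w.2 i : ℤ) : ℝ) + 2))} with hB
  have hcover : periodicBoxes h m S ∩ unitCube d ⊆
      ⋃ w ∈ S ×ˢ Fintype.piFinset (fun _ : Fin d => J), B w := by
    rintro p ⟨⟨z, hzS, hz⟩, hp⟩
    simp only [Set.mem_iUnion]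
    refine ⟨(fun i => z i % (m : ℤ), fun i => z i / (m : ℤ)), ?_, ?_⟩
    · rw [Finset.mem_product, Fintype.mem_piFinset]
      refine ⟨hzS, fun i => ?_⟩
      have h1 := (hz i).1
      have h2 := (hz i).2
      have h3 := (hp i).1
      have h4 := (hp i).2
      have h5 : (0 : ℝ) < (z i : ℝ) + 2 := by
        by_contra! hcon
        nlinarith
      have h6 : (z i : ℝ) ≤ 1 / h + 1 := by
        have : (z i : ℝ) - 1 ≤ 1 / h := by
          rw [le_div_iff₀ hh]; linarith
        linarith
      have h7 : -1 ≤ z i := by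
        have : (0 : ℤ) < z i + 2 := by exact_mod_cast h5
        omega
      simp only [hJ, Finset.mem_Icc]
      constructor
      · rw [Int.le_ediv_iff_mul_le (by exact_mod_cast hm)]
        have : (1 : ℤ) ≤ m := by exact_mod_cast hm
        linarith
      · rw [Int.le_floor, le_div_iff₀ hm']
        refine le_trans ?_ h6
        exact_mod_cast Int.ediv_mul_le (z i) (by exact_mod_cast hm.ne')
    · intro i
      simp only [Int.emod_add_mul_ediv]
      exact hz i
  have hBvol : ∀ w, volume (B w) = ENNReal.ofReal ((3 * h) ^ d) := by
    intro w
    rw [hB, volume_setOf_mem_Ioo, ENNReal.ofReal_pow (by positivity)]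
    rw [Finset.prod_congr rfl (g := fun _ => ENNReal.ofReal (3 * h))]
    · simp
    · intro i _
      congr 1
      ring
  calc volume (periodicBoxes h m S ∩ unitCube d)
      ≤ ∑ w ∈ S ×ˢ Fintype.piFinset (fun _ : Fin d => J), volume (B w) :=
        (measure_mono hcover).trans (measure_biUnion_finset_le _ _)
    _ = ENNReal.ofReal (S.card * ((J.card : ℝ) ^ d * (3 * h) ^ d)) := by
        simp only [hBvol, Finset.sum_const, Finset.card_product, Fintype.card_piFinset,
          Finset.prod_const, Finset.card_univ, Fintype.card_fin, nsmul_eq_mul]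
        rw [← ENNReal.ofReal_natCast, ← ENNReal.ofReal_mul (by positivity)]
        congr 1
        push_cast
        ring
    _ ≤ _ := by gcongr

lemma mem_periodicBoxes_of_close {d : ℕ} {h : ℝ} (hh : 0 < h) {m : ℕ}
    {S : Finset (Fin d → ℤ)} {p q : EuclideanSpace ℝ (Fin d)} (w : Fin d → ℤ)
    (hq : gridCell h m q ∈ S) (hpq : ∀ i, |p i - q i - m * h * w i| < h) :
    p ∈ periodicBoxes h m S := by
  refine ⟨fun i => ⌊q i / h⌋ + m * w i, ?_, fun i => ?_⟩
  · convert hq using 2 with i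
    simp [gridCell, Int.add_mul_emod_self_left]
  · have h1 := Int.floor_le (q i / h)
    have h2 := Int.lt_floor_add_one (q i / h)
    rw [le_div_iff₀ hh] at h1
    rw [div_lt_iff₀ hh] at h2
    have h3 := abs_lt.1 (hpq i)
    push_cast
    constructor <;> nlinarith

lemma gridCell_ne {d : ℕ} {h : ℝ} (hh : 0 < h) {m : ℕ} {p q : EuclideanSpace ℝ (Fin d)}
    (i : Fin d) (h1 : h ≤ |p i - q i|) (h2 : |p i - q i| < h * (m - 1)) :
    gridCell h m p ≠ gridCell h m q := by
  intro heq
  have hi : ⌊p i / h⌋ % (m : ℤ) = ⌊q i / h⌋ % (m : ℤ) := congrFun heq i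
  have hdvd : (m : ℤ) ∣ ⌊q i / h⌋ - ⌊p i / h⌋ := Int.ModEq.dvd hi
  have habs : |p i / h - q i / h| = |p i - q i| / h := by
    rw [← sub_div, abs_div, abs_of_pos hh]
  have hlt : |p i / h - q i / h| < m - 1 := by
    rw [habs, div_lt_iff₀ hh]; linarith
  have hz : ⌊q i / h⌋ - ⌊p i / h⌋ = 0 := by
    refine Int.eq_zero_of_abs_lt_dvd hdvd ?_
    have hp1 := Int.floor_le (p i / h)
    have hp2 := Int.lt_floor_add_one (p i / h)
    have hq1 := Int.floor_le (q i / h)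
    have hq2 := Int.lt_floor_add_one (q i / h)
    have := abs_lt.1 hlt
    have : |((⌊q i / h⌋ - ⌊p i / h⌋ : ℤ) : ℝ)| < ((m : ℤ) : ℝ) := by
      push_cast
      rw [abs_lt]
      constructor <;> linarith
    exact_mod_cast this
  have := Int.abs_sub_lt_one_of_floor_eq_floor (show ⌊p i / h⌋ = ⌊q i / h⌋ by omega)
  rw [habs, div_lt_one hh] at this
  linarith

lemma exists_norm_le_card_mul_abs {d : ℕ} (v : EuclideanSpace ℝ (Fin d)) (hv : v ≠ 0) :
    ∃ i, ‖v‖ ≤ d * |v i| := by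
  by_contra! hcon
  have hd : Nonempty (Fin d) := by
    by_contra! h
    exact hv (Subsingleton.elim _ _)
  have hsum : ‖v‖ ≤ ∑ i, |v i| := by
    conv_lhs => rw [← (EuclideanSpace.basisFun (Fin d) ℝ).sum_repr v]
    refine (norm_sum_le _ _).trans (le_of_eq ?_)
    simp [norm_smul]
  have hlt : ∑ i, (d : ℝ) * |v i| < ∑ _i : Fin d, ‖v‖ :=
    Finset.sum_lt_sum_of_nonempty Finset.univ_nonempty fun i _ => hcon i
  rw [← Finset.mul_sum] at hlt
  simp only [Finset.sum_const, Finset.card_univ, Fintype.card_fin, nsmul_eq_mul] at hlt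
  have : (d : ℝ) * ‖v‖ ≤ d * ∑ i, |v i| := by gcongr
  linarith

lemma abs_apply_sub_apply_le {d : ℕ}
    (T T' : EuclideanSpace ℝ (Fin d) →ₗ[ℝ] EuclideanSpace ℝ (Fin d)) {η : ℝ} (i : Fin d)
    (hT : ∀ j, |T (EuclideanSpace.single j 1) i - T' (EuclideanSpace.single j 1) i| ≤ η)
    (a : EuclideanSpace ℝ (Fin d)) :
    |T a i - T' a i| ≤ d * (η * ‖a‖) := by
  have key : T a i - T' a i = ∑ j, a j *
      (T (EuclideanSpace.single j 1) i - T' (EuclideanSpace.single j 1) i) := by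
    have ha : a = ∑ j, a j • EuclideanSpace.single j (1 : ℝ) := by
      conv_lhs => rw [← (EuclideanSpace.basisFun (Fin d) ℝ).sum_repr a]
      simp
    conv_lhs => rw [ha]
    simp [map_sum, Finset.sum_sub_distrib, mul_sub]
  rw [key]
  refine (Finset.abs_sum_le_sum_abs _ _).trans ?_
  have : ∀ j ∈ Finset.univ, |a j * (T (EuclideanSpace.single j 1) i -
      T' (EuclideanSpace.single j 1) i)| ≤ η * ‖a‖ := by
    intro j _
    rw [abs_mul, mul_comm]
    have : |a j| ≤ ‖a‖ := PiLp.norm_apply_le a j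
    exact mul_le_mul (hT j) this (abs_nonneg _) ((abs_nonneg _).trans (hT j))
  refine (Finset.sum_le_sum this).trans (le_of_eq ?_)
  simp

/-- For a finite set `F` in the ball of radius `r` whose points are `s`-separated, there is an
open set of small measure in the unit cube which meets every affine copy of `F` under a map that
distorts norms by a factor of at most `k`. -/
lemma exists_isOpen_meets_affine_copies_s2 {d : ℕ} (hd : 1 ≤ d)
    (F : Finset (EuclideanSpace ℝ (Fin d))) (hF : F.Nonempty) {r s k : ℝ} (hs0 : 0 < s)
    (hsr : s ≤ 2 * r) (hk : 1 ≤ k) (hr : ∀ a ∈ F, ‖a‖ ≤ r)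
    (hs : ∀ a ∈ F, ∀ b ∈ F, a ≠ b → s ≤ ‖a - b‖) :
    ∃ U : Set (EuclideanSpace ℝ (Fin d)), IsOpen U ∧
      volume (U ∩ unitCube d) ≤ ENNReal.ofReal
        (((d ^ 2 + d) * Real.log (16 * k ^ 2 * d ^ 2 * (r / s)) + 1) / F.card *
          (3 * (1 + 18 * (k * r))) ^ d) ∧
      ∀ (T : EuclideanSpace ℝ (Fin d) →ₗ[ℝ] EuclideanSpace ℝ (Fin d))
        (x : EuclideanSpace ℝ (Fin d)), (∀ y, ‖T y‖ ≤ k * ‖y‖) → (∀ y, ‖y‖ ≤ k * ‖T y‖) →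
        ∃ a ∈ F, T a + x ∈ U := by
  classical
  have hd' : (1 : ℝ) ≤ d := by exact_mod_cast hd
  have hd0 : (0 : ℝ) < d := by linarith
  have hk0 : 0 < k := by linarith
  have hr0 : 0 < r := by linarith
  have hN : 0 < F.card := hF.card_pos
  have hN' : (0 : ℝ) < F.card := by exact_mod_cast hN
  set h : ℝ := s / (k * d) with hh
  have hh0 : 0 < h := by positivity
  have hhs : h ≤ s := div_le_self hs0.le (by nlinarith)
  set m : ℕ := ⌈2 * k * r / h⌉₊ + 2 with hm
  have hml : 2 * k * r / h + 2 ≤ m := by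
    rw [hm]; push_cast; linarith [Nat.le_ceil (2 * k * r / h)]
  have hmu : (m : ℝ) < 2 * k * r / h + 3 := by
    rw [hm]; push_cast; linarith [Nat.ceil_lt_add_one (show 0 ≤ 2 * k * r / h by positivity)]
  have hm0 : 0 < m := by omega
  have hm0' : (0 : ℝ) < m := by exact_mod_cast hm0
  set η : ℝ := h / (2 * d * r) with hη
  have hη0 : 0 < η := by positivity
  set P : Set ((EuclideanSpace ℝ (Fin d) →ₗ[ℝ] EuclideanSpace ℝ (Fin d)) ×
      EuclideanSpace ℝ (Fin d)) :=
    {p | (∀ y, ‖p.1 y‖ ≤ k * ‖y‖) ∧ ∀ y, ‖y‖ ≤ k * ‖p.1 y‖} with hP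
  set code : (EuclideanSpace ℝ (Fin d) →ₗ[ℝ] EuclideanSpace ℝ (Fin d)) ×
      EuclideanSpace ℝ (Fin d) → (Fin d × Fin d → ℤ) × (Fin d → ℤ) := fun p =>
    (fun ij => ⌊p.1 (EuclideanSpace.single ij.1 1) ij.2 / η⌋,
      fun i => ⌊p.2 i / (h / 2)⌋ % ((2 * m : ℕ) : ℤ)) with hcode
  set I : Finset ℤ := Finset.Icc ⌊-(k / η)⌋ ⌊k / η⌋ with hI
  set K₀ : Finset ((Fin d × Fin d → ℤ) × (Fin d → ℤ)) :=
    Fintype.piFinset (fun _ => I) ×ˢ Fintype.piFinset (fun _ => Finset.Ico 0 ((2 * m : ℕ) : ℤ))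
    with hK₀
  have hcodeK : ∀ p ∈ P, code p ∈ K₀ := by
    intro p hp
    simp only [hK₀, hcode, Finset.mem_product, Fintype.mem_piFinset, hI, Finset.mem_Icc,
      Finset.mem_Ico]
    refine ⟨fun ij => ?_, fun i => ?_⟩
    · have h1 : |p.1 (EuclideanSpace.single ij.1 1) ij.2| ≤ k := by
        refine (PiLp.norm_apply_le _ _).trans ((hp.1 _).trans (le_of_eq ?_))
        simp
      rw [abs_le] at h1
      constructor
      · refine Int.floor_le_floor ?_
        rw [← neg_div]
        exact div_le_div_of_nonneg_right h1.1 hη0.le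
      · exact Int.floor_le_floor (div_le_div_of_nonneg_right h1.2 hη0.le)
    · exact ⟨Int.emod_nonneg _ (by exact_mod_cast (by omega : 2 * m ≠ 0)),
        Int.emod_lt_of_pos _ (by exact_mod_cast (by omega : 0 < 2 * m))⟩
  set K := K₀.filter fun κ => ∃ p ∈ P, code p = κ with hK
  have hid : ((LinearMap.id, 0) : (EuclideanSpace ℝ (Fin d) →ₗ[ℝ] EuclideanSpace ℝ (Fin d)) ×
      EuclideanSpace ℝ (Fin d)) ∈ P := by
    have : ∀ y : EuclideanSpace ℝ (Fin d), ‖y‖ ≤ k * ‖y‖ := fun y => by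
      nlinarith [norm_nonneg y]
    exact ⟨this, this⟩
  have hKne : K.Nonempty :=
    ⟨code (LinearMap.id, 0), Finset.mem_filter.2 ⟨hcodeK _ hid, _, hid, rfl⟩⟩
  have hrep : ∀ κ ∈ K, ∃ p ∈ P, code p = κ := fun κ hκ => (Finset.mem_filter.1 hκ).2
  choose! rep hrepP hrepc using hrep
  set G : Finset (Fin d → ℤ) := Fintype.piFinset fun _ => Finset.Ico 0 (m : ℤ) with hG
  have hGcard : (G.card : ℝ) = (m : ℝ) ^ d := by simp [hG]
  obtain ⟨S, hS, hhit⟩ := exists_hitting_finset G K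
    (fun κ => F.image fun a => gridCell h m ((rep κ).1 a + (rep κ).2)) F.card hN hKne (by
      intro κ hκ
      obtain ⟨hp1, hp2⟩ := hrepP κ hκ
      constructor
      · intro z hz
        obtain ⟨a, -, rfl⟩ := Finset.mem_image.1 hz
        rw [hG, Fintype.mem_piFinset]
        intro i
        rw [Finset.mem_Ico]
        exact ⟨Int.emod_nonneg _ (by exact_mod_cast hm0.ne'),
          Int.emod_lt_of_pos _ (by exact_mod_cast hm0)⟩
      · refine le_of_eq (Finset.card_image_of_injOn ?_).symm
        intro a ha b hb hab
        by_contra hne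
        have hsep := hs a ha b hb hne
        have hv : s ≤ k * ‖(rep κ).1 (a - b)‖ := hsep.trans (hp2 _)
        have hv0 : (rep κ).1 (a - b) ≠ 0 := by
          intro h0
          rw [h0, norm_zero, mul_zero] at hv
          linarith
        obtain ⟨i, hi⟩ := exists_norm_le_card_mul_abs _ hv0
        have hdiff : ((rep κ).1 a + (rep κ).2) i - ((rep κ).1 b + (rep κ).2) i =
            (rep κ).1 (a - b) i := by simp [map_sub]
        refine gridCell_ne hh0 (m := m) i ?_ ?_ hab
        · rw [hdiff, hh, div_le_iff₀ (by positivity)]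
          calc s ≤ k * (d * |(rep κ).1 (a - b) i|) := hv.trans (by gcongr)
            _ = _ := by ring
        · rw [hdiff]
          have h1 : |(rep κ).1 (a - b) i| ≤ k * (r + r) :=
            (PiLp.norm_apply_le _ _).trans ((hp1 _).trans (by
              gcongr
              exact (norm_sub_le _ _).trans (add_le_add (hr a ha) (hr b hb))))
          have h2 : h * (2 * k * r / h + 2 - 1) ≤ h * (m - 1) := by gcongr
          have h3 : h * (2 * k * r / h + 2 - 1) = 2 * k * r + h := by field_simp; ring
          linarith)
  refine ⟨periodicBoxes h m S, isOpen_periodicBoxes _ _ _,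
    (volume_periodicBoxes_inter_le hh0 hm0 S).trans (ENNReal.ofReal_le_ofReal ?_), ?_⟩
  · set Q : ℝ := 16 * k ^ 2 * d ^ 2 * (r / s) with hQ
    have hrs : 1 ≤ 2 * (r / s) := by
      rw [← mul_div_assoc, le_div_iff₀ hs0]; linarith
    have hkd : 1 ≤ k ^ 2 * d := by nlinarith
    have hX : k ^ 2 * d ≤ k ^ 2 * d ^ 2 := by nlinarith
    have hXY : k ^ 2 * d * (r / s) ≤ k ^ 2 * d ^ 2 * (r / s) := by gcongr
    have hY : r / s ≤ k ^ 2 * d ^ 2 * (r / s) :=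
      le_mul_of_one_le_left (by positivity) (hkd.trans hX)
    have hQ1 : 1 ≤ Q := by rw [hQ]; nlinarith
    have hIcard : (I.card : ℝ) ≤ Q := by
      have h0 : ⌊-(k / η)⌋ ≤ ⌊k / η⌋ := Int.floor_le_floor (by
        have : 0 < k / η := by positivity
        linarith)
      rw [hI, Int.card_Icc]
      have h1 := Int.floor_le (k / η)
      have h2 := Int.lt_floor_add_one (-(k / η))
      have h3 : (((⌊k / η⌋ + 1 - ⌊-(k / η)⌋).toNat : ℤ) : ℝ) =
          ((⌊k / η⌋ + 1 - ⌊-(k / η)⌋ : ℤ) : ℝ) := by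
        rw [Int.toNat_of_nonneg (by omega)]
      push_cast at h3
      have h4 : k / η = 2 * (k ^ 2 * d ^ 2 * (r / s)) := by
        rw [hη, hh]; field_simp
      rw [hQ]
      linarith
    have hmQ : ((2 * m : ℕ) : ℝ) ≤ Q := by
      have : 2 * k * r / h = 2 * (k ^ 2 * d * (r / s)) := by rw [hh]; field_simp
      push_cast
      rw [hQ]
      linarith
    have hKcard : (K.card : ℝ) ≤ Q ^ (d ^ 2 + d) := by
      have h1 : (K.card : ℝ) ≤ K₀.card := by exact_mod_cast Finset.card_filter_le _ _
      have h2 : (K₀.card : ℝ) = (I.card : ℝ) ^ (d ^ 2) * ((2 * m : ℕ) : ℝ) ^ d := by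
        rw [hK₀, Finset.card_product, Fintype.card_piFinset, Fintype.card_piFinset,
          Finset.prod_const, Finset.prod_const, Int.card_Ico, sub_zero, Int.toNat_natCast]
        simp [sq]
      rw [pow_add]
      refine h1.trans (h2.le.trans ?_)
      gcongr
    have hlogK : Real.log K.card ≤ (d ^ 2 + d) * Real.log Q := by
      have h1 : (0 : ℝ) < K.card := by exact_mod_cast hKne.card_pos
      refine (Real.log_le_log h1 hKcard).trans (le_of_eq ?_)
      rw [Real.log_pow]; push_cast; ring
    have hSm : (S.card : ℝ) ≤ m ^ d * (((d ^ 2 + d) * Real.log Q + 1) / F.card) := by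
      rw [← mul_div_assoc, le_div_iff₀ hN']
      refine hS.trans ?_
      rw [hGcard]
      gcongr
    have hbase : m * (((1 / h + 1) / m + 2) * (3 * h)) ≤ 3 * (1 + 18 * (k * r)) := by
      have h1 : m * (((1 / h + 1) / m + 2) * (3 * h)) = 3 * (1 + h + 2 * (m * h)) := by
        field_simp
      have h2 : m * h ≤ (2 * k * r / h + 3) * h := by gcongr
      have h3 : (2 * k * r / h + 3) * h = 2 * k * r + 3 * h := by field_simp
      have h4 : r ≤ k * r := le_mul_of_one_le_left hr0.le hk
      rw [h1]
      linarith
    have hlogQ : 0 ≤ Real.log Q := Real.log_nonneg hQ1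
    calc (S.card : ℝ) * (((1 / h + 1) / m + 2) ^ d * (3 * h) ^ d)
        ≤ (m ^ d * (((d ^ 2 + d) * Real.log Q + 1) / F.card)) *
            (((1 / h + 1) / m + 2) ^ d * (3 * h) ^ d) := by gcongr
      _ = (((d ^ 2 + d) * Real.log Q + 1) / F.card) *
            (m * (((1 / h + 1) / m + 2) * (3 * h))) ^ d := by
          rw [mul_pow (m : ℝ), mul_pow ((1 / h + 1) / (m : ℝ) + 2)]; ring
      _ ≤ _ := by gcongr
  · intro T x hT1 hT2
    have hTP : (T, x) ∈ P := ⟨hT1, hT2⟩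
    have hκ : code (T, x) ∈ K := Finset.mem_filter.2 ⟨hcodeK _ hTP, _, hTP, rfl⟩
    obtain ⟨c, hc, hcS⟩ := hhit _ hκ
    obtain ⟨a, ha, rfl⟩ := Finset.mem_image.1 hc
    have hceq := hrepc _ hκ
    set p := rep (code (T, x)) with hp
    have hw : ∀ i, ∃ w : ℤ, |x i - p.2 i - m * h * w| < h / 2 := by
      intro i
      have h1 : ⌊p.2 i / (h / 2)⌋ % ((2 * m : ℕ) : ℤ) = ⌊x i / (h / 2)⌋ % ((2 * m : ℕ) : ℤ) :=
        congrFun (congrArg Prod.snd hceq) i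
      obtain ⟨w, hw⟩ := Int.ModEq.dvd h1
      refine ⟨w, ?_⟩
      have hw' : (⌊x i / (h / 2)⌋ : ℝ) - ⌊p.2 i / (h / 2)⌋ = 2 * m * w := by exact_mod_cast hw
      have hh2 : 0 < h / 2 := by positivity
      have h2 := Int.floor_le (x i / (h / 2))
      have h3 := Int.lt_floor_add_one (x i / (h / 2))
      have h4 := Int.floor_le (p.2 i / (h / 2))
      have h5 := Int.lt_floor_add_one (p.2 i / (h / 2))
      have h6 : |x i / (h / 2) - p.2 i / (h / 2) - 2 * m * w| < 1 := by
        rw [abs_lt]; constructor <;> linarith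
      have h7 : x i / (h / 2) - p.2 i / (h / 2) - 2 * m * w =
          (x i - p.2 i - m * h * w) / (h / 2) := by field_simp
      rw [h7, abs_div, abs_of_pos hh2, div_lt_one hh2] at h6
      exact h6
    choose w hw using hw
    refine ⟨a, ha, mem_periodicBoxes_of_close hh0 w hcS fun i => ?_⟩
    have h1 : |T a i - p.1 a i| ≤ d * (η * ‖a‖) := by
      refine abs_apply_sub_apply_le T p.1 i (fun j => ?_) a
      have h1 : ⌊p.1 (EuclideanSpace.single j 1) i / η⌋ =
          ⌊T (EuclideanSpace.single j 1) i / η⌋ :=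
        congrFun (congrArg Prod.fst hceq) (j, i)
      have h2 := Int.abs_sub_lt_one_of_floor_eq_floor h1.symm
      rw [← sub_div, abs_div, abs_of_pos hη0, div_lt_one hη0] at h2
      exact h2.le
    have h2 : d * (η * ‖a‖) ≤ h / 2 := by
      calc d * (η * ‖a‖) ≤ d * (η * r) := by gcongr; exact hr a ha
        _ = h / 2 := by rw [hη]; field_simp
    have h3 : (T a + x) i - (p.1 a + p.2) i - m * h * w i =
        (T a i - p.1 a i) + (x i - p.2 i - m * h * w i) := by simp; ring
    rw [h3]
    refine (abs_add_le _ _).trans_lt ?_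
    linarith [hw i]

lemma exists_delta_eq {d : ℕ} {F : Set (EuclideanSpace ℝ (Fin d))} (hF : F.Finite)
    (h2 : 2 ≤ F.ncard) :
    ∃ r s : ℝ, 0 < s ∧ s ≤ 2 * r ∧ delta F = s / r ∧ (∃ z ∈ F, ‖z‖ = r) ∧ (∀ a ∈ F, ‖a‖ ≤ r) ∧
      ∀ a ∈ F, ∀ b ∈ F, a ≠ b → s ≤ ‖a - b‖ := by
  obtain ⟨x, hx, y, hy, hxy⟩ := (Set.one_lt_ncard hF).1 h2
  set D := {s : ℝ | ∃ x ∈ F, ∃ y ∈ F, x ≠ y ∧ ‖x - y‖ = s} with hD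
  set R := {s : ℝ | ∃ z ∈ F, ‖z‖ = s} with hR
  have hDfin : D.Finite := by
    refine ((hF.prod hF).image fun p => ‖p.1 - p.2‖).subset ?_
    rintro _ ⟨x, hx, y, hy, -, rfl⟩
    exact ⟨(x, y), ⟨hx, hy⟩, rfl⟩
  have hRfin : R.Finite := hF.image fun z => ‖z‖
  have hDne : D.Nonempty := ⟨_, x, hx, y, hy, hxy, rfl⟩
  have hRne : R.Nonempty := ⟨_, x, hx, rfl⟩
  have hr : ∀ a ∈ F, ‖a‖ ≤ sSup R := fun a ha => le_csSup hRfin.bddAbove ⟨a, ha, rfl⟩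
  have hs : ∀ a ∈ F, ∀ b ∈ F, a ≠ b → sInf D ≤ ‖a - b‖ := fun a ha b hb hab =>
    csInf_le hDfin.bddBelow ⟨a, ha, b, hb, hab, rfl⟩
  refine ⟨sSup R, sInf D, ?_, ?_, rfl, hRne.csSup_mem hRfin, hr, hs⟩
  · obtain ⟨a, -, b, -, hab, h⟩ := hDne.csInf_mem hDfin
    rw [← h]
    exact norm_pos_iff.2 (sub_ne_zero.2 hab)
  · have h1 := hs x hx y hy hxy
    have h2 := norm_sub_le x y
    linarith [hr x hx, hr y hy]

/-- **Generalization of Kolountzakis's theorem.**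
If `A ⊆ ℝ^d` is bounded and infinite and admits finite subsets `A_n ⊆ A` with
`#A_n → ∞` and `(−log δ(A_n))/#A_n → 0`, then there is a closed set `E ⊆ [0,1]^d`
of positive measure containing no affine copy of `A`. -/
theorem stmt2 (d : ℕ) (hd : 1 ≤ d) (A : Set (EuclideanSpace ℝ (Fin d)))
    (hbdd : Bornology.IsBounded A) (hinf : A.Infinite)
    (An : ℕ → Set (EuclideanSpace ℝ (Fin d)))
    (hfin : ∀ n, (An n).Finite) (hsub : ∀ n, An n ⊆ A)
    (hcard2 : ∀ n, 2 ≤ (An n).ncard)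
    (hcard : Tendsto (fun n => (An n).ncard) atTop atTop)
    (hlog : Tendsto (fun n => -Real.log (delta (An n)) / ((An n).ncard : ℝ))
      atTop (nhds 0)) :
    ∃ E : Set (EuclideanSpace ℝ (Fin d)), IsClosed E ∧ E ⊆ unitCube d ∧
      0 < volume E ∧
      ∀ (T : EuclideanSpace ℝ (Fin d) ≃ₗ[ℝ] EuclideanSpace ℝ (Fin d))
        (v : EuclideanSpace ℝ (Fin d)),
        ¬ ((fun a => T a + v) '' A ⊆ E) := by
  obtain ⟨R, hR⟩ := hbdd.exists_norm_le
  have hU : ∀ (k : ℕ), ∃ U : Set (EuclideanSpace ℝ (Fin d)), IsOpen U ∧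
      volume (U ∩ unitCube d) ≤ (2⁻¹ : ENNReal) ^ (k + 2) ∧
      ∀ (T : EuclideanSpace ℝ (Fin d) →ₗ[ℝ] EuclideanSpace ℝ (Fin d))
        (x : EuclideanSpace ℝ (Fin d)), (∀ y, ‖T y‖ ≤ (k + 1 : ℝ) * ‖y‖) →
        (∀ y, ‖y‖ ≤ (k + 1 : ℝ) * ‖T y‖) → ∃ a ∈ A, T a + x ∈ U := by
    intro k
    have hcardR : Tendsto (fun n => ((An n).ncard : ℝ)) atTop atTop :=
      tendsto_natCast_atTop_atTop.comp hcard
    set c : ℝ := 16 * ((k : ℝ) + 1) ^ 2 * d ^ 2 with hc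
    set V : ℝ := (3 * (1 + 18 * ((k + 1) * R))) ^ d with hV
    have hlim : Tendsto (fun n => ((d ^ 2 + d) * (-Real.log (delta (An n)) / (An n).ncard) +
        ((d ^ 2 + d) * Real.log c + 1) / (An n).ncard) * V) atTop (nhds 0) := by
      have := ((hlog.const_mul ((d : ℝ) ^ 2 + d)).add
        (hcardR.const_div_atTop ((d ^ 2 + d) * Real.log c + 1))).mul_const V
      simpa using this
    have hpos : (0 : ℝ) < 2⁻¹ ^ (k + 2) := by positivity
    obtain ⟨n, hn⟩ := (hlim.eventually (gt_mem_nhds hpos)).exists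
    obtain ⟨r, s, hs0, hsr, hδ, ⟨z, hz, hzr⟩, hr, hs⟩ := exists_delta_eq (hfin n) (hcard2 n)
    have hr0 : 0 < r := by linarith
    have hrR : r ≤ R := hzr ▸ hR z (hsub n hz)
    have hne : (hfin n).toFinset.Nonempty := ⟨z, by simpa using hz⟩
    obtain ⟨U, hUo, hUv, hUT⟩ := exists_isOpen_meets_affine_copies_s2 hd (hfin n).toFinset hne
      (k := (k : ℝ) + 1) hs0 hsr (by simp) (by simpa using hr) (by simpa using hs)
    refine ⟨U, hUo, hUv.trans ?_, fun T x h1 h2 => ?_⟩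
    · have h2 : (2⁻¹ : ENNReal) ^ (k + 2) = ENNReal.ofReal (2⁻¹ ^ (k + 2)) := by
        rw [ENNReal.ofReal_pow (by norm_num), ENNReal.ofReal_inv_of_pos (by norm_num)]
        simp
      rw [h2]
      refine ENNReal.ofReal_le_ofReal (le_trans ?_ hn.le)
      have hd' : (1 : ℝ) ≤ d := by exact_mod_cast hd
      have hc0 : 0 < c := by positivity
      have hcrs : 1 ≤ c * (r / s) := by
        have h1 : 1 ≤ 2 * (r / s) := by
          rw [← mul_div_assoc, le_div_iff₀ hs0]; linarith
        have h2 : (1 : ℝ) ≤ (k + 1) ^ 2 * d ^ 2 :=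
          one_le_mul_of_one_le_of_one_le (one_le_pow₀ (by simp)) (one_le_pow₀ hd')
        nlinarith
      have hlogc : 0 ≤ Real.log (c * (r / s)) := Real.log_nonneg hcrs
      have hlogeq : Real.log (c * (r / s)) = Real.log c - Real.log (delta (An n)) := by
        rw [hδ, Real.log_mul hc0.ne' (by positivity), ← inv_div, Real.log_inv]
        ring
      rw [← Set.ncard_eq_toFinset_card _ (hfin n)]
      calc _ ≤ (((d : ℝ) ^ 2 + d) * Real.log (c * (r / s)) + 1) / (An n).ncard * V := by
            rw [hV]; gcongr
        _ = _ := by rw [hlogeq]; ring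
    · obtain ⟨a, ha, haU⟩ := hUT T x h1 h2
      exact ⟨a, hsub n (by simpa using ha), haU⟩
  choose U hUo hUv hUT using hU
  refine ⟨unitCube d \ ⋃ k, U k, (isClosed_unitCube d).sdiff (isOpen_iUnion hUo),
    sdiff_subset, ?_, ?_⟩
  · have hvol : volume ((⋃ k, U k) ∩ unitCube d) ≤ 2⁻¹ := by
      rw [iUnion_inter]
      refine (measure_iUnion_le _).trans ((ENNReal.tsum_le_tsum hUv).trans ?_)
      have : ∀ k : ℕ, (2⁻¹ : ENNReal) ^ (k + 2) = 2⁻¹ * 2⁻¹ ^ (k + 1) := fun k => by ring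
      simp only [this]
      rw [ENNReal.tsum_mul_left, ENNReal.tsum_geometric_add_one, ENNReal.one_sub_inv_two, inv_inv,
        ENNReal.inv_mul_cancel (by simp) (by simp), mul_one]
    rw [pos_iff_ne_zero]
    intro h0
    have hle : volume (unitCube d) ≤ volume (unitCube d \ ⋃ k, U k) +
        volume ((⋃ k, U k) ∩ unitCube d) := by
      refine (measure_mono ?_).trans (measure_union_le _ _)
      intro p hp
      by_cases h : p ∈ ⋃ k, U k
      · exact Or.inr ⟨h, hp⟩
      · exact Or.inl ⟨hp, h⟩
    rw [h0, zero_add, volume_unitCube] at hle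
    exact absurd (hle.trans hvol) (by simp [ENNReal.one_le_inv])
  · intro T v hT
    set L := T.toContinuousLinearEquiv with hL
    obtain ⟨k, hk⟩ := exists_nat_ge
      (max ‖(L : EuclideanSpace ℝ (Fin d) →L[ℝ] EuclideanSpace ℝ (Fin d))‖
        ‖(L.symm : EuclideanSpace ℝ (Fin d) →L[ℝ] EuclideanSpace ℝ (Fin d))‖)
    obtain ⟨hk1, hk2⟩ := max_le_iff.1 hk
    obtain ⟨a, ha, haU⟩ := hUT k (T : EuclideanSpace ℝ (Fin d) →ₗ[ℝ] EuclideanSpace ℝ (Fin d)) v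
      (fun y => by
        refine ((L : EuclideanSpace ℝ (Fin d) →L[ℝ] EuclideanSpace ℝ (Fin d)).le_opNorm y).trans ?_
        gcongr
        linarith)
      (fun y => by
        have h := (L.symm : EuclideanSpace ℝ (Fin d) →L[ℝ] EuclideanSpace ℝ (Fin d)).le_opNorm
          (L y)
        simp only [ContinuousLinearEquiv.coe_coe, ContinuousLinearEquiv.symm_apply_apply] at h
        refine h.trans ?_
        change _ ≤ ((k : ℝ) + 1) * ‖L y‖
        gcongr
        linarith)
    exact (hT ⟨a, ha, rfl⟩).2 (mem_iUnion.2 ⟨k, haU⟩)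
end

section
/- Let d ≥ 1 and 0 < α < 1. There exists a constant C > 0 depending only on α and d with the following property. Let A₀ = {x_1, …, x_k} ⊆ ℝ^d ∖ {0} be a finite set with k ≥ 2 distinct elements, let x ∈ [0,1]^d, let M := max{‖x_i‖ : 1 ≤ i ≤ k}, δ := δ(A₀), and L := ⌈ d/(α M δ) ⌉. Then there exists a finite set S ⊆ S_α^{1/α} with #S ≤ C (L M k)^{d²} such that: for every set E ⊆ [0,1]^d that is a union of open grid cubes I_j(L) with j ∈ {0,…,L−1}^d, if there exists T ∈ S_α^{1/α} with TA₀ + x ⊆ E, then there exists S ∈ S with SA₀ + x ⊆ E. -/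
open MeasureTheory Filter Set

/-- `‖T‖* = max_{‖u‖ = 1} ‖T u‖`. -/
noncomputable def opMax {d : ℕ}
    (T : EuclideanSpace ℝ (Fin d) →ₗ[ℝ] EuclideanSpace ℝ (Fin d)) : ℝ :=
  sSup {s : ℝ | ∃ u : EuclideanSpace ℝ (Fin d), ‖u‖ = 1 ∧ ‖T u‖ = s}

/-- `‖T‖_* = min_{‖u‖ = 1} ‖T u‖`. -/
noncomputable def opMin {d : ℕ}
    (T : EuclideanSpace ℝ (Fin d) →ₗ[ℝ] EuclideanSpace ℝ (Fin d)) : ℝ :=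
  sInf {s : ℝ | ∃ u : EuclideanSpace ℝ (Fin d), ‖u‖ = 1 ∧ ‖T u‖ = s}

/-- Membership in `S_α^β`: an invertible linear map `T` with `α < ‖T‖_*` and `‖T‖* < β`. -/
def memS {d : ℕ} (α β : ℝ)
    (T : EuclideanSpace ℝ (Fin d) ≃ₗ[ℝ] EuclideanSpace ℝ (Fin d)) : Prop :=
  α < opMin (T : EuclideanSpace ℝ (Fin d) →ₗ[ℝ] EuclideanSpace ℝ (Fin d)) ∧
    opMax (T : EuclideanSpace ℝ (Fin d) →ₗ[ℝ] EuclideanSpace ℝ (Fin d)) < β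

/-- The open grid cube `I_j(L) = ∏_i (j_i/L, (j_i+1)/L)`. -/
def gridCube (d L : ℕ) (j : Fin d → ℕ) : Set (EuclideanSpace ℝ (Fin d)) :=
  {y | ∀ i, (j i : ℝ) / L < y i ∧ y i < ((j i : ℝ) + 1) / L}

/-- The set of indices at which the affine functions `f i + a i` are nonnegative at `v`. -/
noncomputable def nonnegPattern {ι V : Type*} [Fintype ι] [AddCommGroup V] [Module ℝ V]
    (f : ι → Module.Dual ℝ V) (a : ι → ℝ) (v : V) : Finset ι :=
  open Classical in Finset.univ.filter fun i => 0 ≤ f i v + a i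

theorem mem_nonnegPattern {ι V : Type*} [Fintype ι] [AddCommGroup V] [Module ℝ V]
    {f : ι → Module.Dual ℝ V} {a : ι → ℝ} {v : V} {i : ι} :
    i ∈ nonnegPattern f a v ↔ 0 ≤ f i v + a i := by
  simp [nonnegPattern]

/-- A nontrivial linear relation with a positive coefficient between the linear parts of affine
functions prevents their nonnegativity patterns from shattering the index set. -/
theorem false_of_dual_relation {ι V : Type*} [Fintype ι] [AddCommGroup V] [Module ℝ V]
    (f : ι → Module.Dual ℝ V) (a : ι → ℝ) (s : Finset ι) (c : s → ℝ)
    (hc : ∑ i, c i • f i = 0) (i₀ : s) (hi₀ : 0 < c i₀)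
    (hs : ∀ t ⊆ s, ∃ v, ∀ i ∈ s, i ∈ nonnegPattern f a v ↔ i ∈ t) : False := by
  classical
  have hconst (v : V) : ∑ i, c i * (f i v + a i) = ∑ i, c i * a i := by
    have h := congrArg (fun g : Module.Dual ℝ V => g v) hc
    simp only [LinearMap.sum_apply, LinearMap.smul_apply, smul_eq_mul, LinearMap.zero_apply] at h
    simp only [mul_add, Finset.sum_add_distrib, h, zero_add]
  obtain ⟨v, hv⟩ := hs ((Finset.univ.filter fun i : s => 0 < c i).image (↑)) (by
    intro i hi; obtain ⟨j, -, rfl⟩ := Finset.mem_image.1 hi; exact j.2)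
  obtain ⟨w, hw⟩ := hs ((Finset.univ.filter fun i : s => c i < 0).image (↑)) (by
    intro i hi; obtain ⟨j, -, rfl⟩ := Finset.mem_image.1 hi; exact j.2)
  have hv' (i : s) : 0 ≤ f i v + a i ↔ 0 < c i := by
    rw [← mem_nonnegPattern, hv i i.2]; simp
  have hw' (i : s) : 0 ≤ f i w + a i ↔ c i < 0 := by
    rw [← mem_nonnegPattern, hw i i.2]; simp
  have h1 : 0 ≤ ∑ i, c i * (f i v + a i) := by
    refine Finset.sum_nonneg fun i _ => ?_
    by_cases h : 0 < c i
    · exact mul_nonneg h.le ((hv' i).2 h)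
    · exact mul_nonneg_of_nonpos_of_nonpos (not_lt.1 h)
        (not_le.1 fun h' => h ((hv' i).1 h')).le
  have h2 : ∑ i, c i * (f i w + a i) < 0 := by
    have key (i : s) : c i * (f i w + a i) ≤ 0 := by
      by_cases h : c i < 0
      · exact mul_nonpos_of_nonpos_of_nonneg h.le ((hw' i).2 h)
      · exact mul_nonpos_of_nonneg_of_nonpos (not_lt.1 h)
          (not_le.1 fun h' => h ((hw' i).1 h')).le
    refine Finset.sum_neg' (fun i _ => key i) ⟨i₀, Finset.mem_univ _, ?_⟩
    exact mul_neg_of_pos_of_neg hi₀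
      (not_le.1 fun h' => lt_asymm hi₀ ((hw' i₀).1 h'))
  rw [hconst] at h1 h2
  linarith

/-- Nonnegativity patterns of affine functions shatter only sets of size at most the dimension. -/
theorem card_le_finrank_of_nonnegPattern_shatters {ι V : Type*} [Fintype ι] [AddCommGroup V]
    [Module ℝ V] [FiniteDimensional ℝ V] (f : ι → Module.Dual ℝ V) (a : ι → ℝ) (s : Finset ι)
    (hs : ∀ t ⊆ s, ∃ v, ∀ i ∈ s, i ∈ nonnegPattern f a v ↔ i ∈ t) :
    s.card ≤ Module.finrank ℝ V := by
  by_contra! hlt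
  have hdep : ¬ LinearIndependent ℝ (fun i : s => f i) := by
    intro h
    have := h.fintype_card_le_finrank
    rw [Subspace.dual_finrank_eq, Fintype.card_coe] at this
    omega
  obtain ⟨c, hc, i₀, hi₀⟩ := Fintype.not_linearIndependent_iff.1 hdep
  rcases lt_or_gt_of_ne hi₀ with h | h
  · have hc' : ∑ i, (-c) i • f i = 0 := by
      ext v
      have hv := congrArg (fun g : Module.Dual ℝ V => g v) hc
      simp only [LinearMap.sum_apply, LinearMap.smul_apply, smul_eq_mul,
        LinearMap.zero_apply] at hv
      simp only [LinearMap.sum_apply, LinearMap.smul_apply, smul_eq_mul, LinearMap.zero_apply,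
        Pi.neg_apply, neg_mul, Finset.sum_neg_distrib, hv, neg_zero]
    exact false_of_dual_relation f a s (-c) hc' i₀ (by simpa using h) hs
  · exact false_of_dual_relation f a s c hc i₀ h hs

theorem ncard_range_nonnegPattern_le {ι V : Type*} [Fintype ι] [Nonempty ι] [AddCommGroup V]
    [Module ℝ V] [FiniteDimensional ℝ V] (f : ι → Module.Dual ℝ V) (a : ι → ℝ) :
    (Set.range (nonnegPattern f a)).ncard ≤
      (Module.finrank ℝ V + 1) * Fintype.card ι ^ Module.finrank ℝ V := by
  classical
  set 𝒜 := (Set.toFinite (Set.range (nonnegPattern f a))).toFinset with h𝒜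
  have hvc : 𝒜.vcDim ≤ Module.finrank ℝ V := by
    refine Finset.sup_le fun s hs => ?_
    refine card_le_finrank_of_nonnegPattern_shatters f a s fun t ht => ?_
    obtain ⟨u, hu, hut⟩ := (Finset.mem_shatterer.1 hs) ht
    rw [h𝒜, Set.Finite.mem_toFinset] at hu
    obtain ⟨v, rfl⟩ := hu
    refine ⟨v, fun i hi => ?_⟩
    rw [← hut]
    simp [hi]
  rw [Set.ncard_eq_toFinset_card _ (Set.toFinite _), ← h𝒜]
  calc 𝒜.card ≤ 𝒜.shatterer.card := Finset.card_le_card_shatterer 𝒜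
    _ ≤ ∑ j ∈ Finset.Iic 𝒜.vcDim, (Fintype.card ι).choose j :=
      Finset.card_shatterer_le_sum_vcDim
    _ ≤ ∑ j ∈ Finset.Iic (Module.finrank ℝ V), (Fintype.card ι).choose j :=
      Finset.sum_le_sum_of_subset (Finset.Iic_subset_Iic.2 hvc)
    _ ≤ ∑ j ∈ Finset.Iic (Module.finrank ℝ V), Fintype.card ι ^ Module.finrank ℝ V := by
      refine Finset.sum_le_sum fun j hj => ?_
      exact (Nat.choose_le_pow _ _).trans
        (Nat.pow_le_pow_right Fintype.card_pos (Finset.mem_Iic.1 hj))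
    _ = _ := by simp

theorem norm_apply_le_of_memS {d : ℕ} {α β : ℝ}
    {T : EuclideanSpace ℝ (Fin d) ≃ₗ[ℝ] EuclideanSpace ℝ (Fin d)} (hT : memS α β T)
    (v : EuclideanSpace ℝ (Fin d)) : ‖T v‖ ≤ β * ‖v‖ := by
  rcases eq_or_ne v 0 with rfl | hv
  · simp
  have hv' : 0 < ‖v‖ := norm_pos_iff.2 hv
  have hbdd : BddAbove {s : ℝ | ∃ u, ‖u‖ = 1 ∧
      ‖(T : EuclideanSpace ℝ (Fin d) →ₗ[ℝ] EuclideanSpace ℝ (Fin d)) u‖ = s} := by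
    refine ⟨‖(T : EuclideanSpace ℝ (Fin d) →ₗ[ℝ] EuclideanSpace ℝ (Fin d)).toContinuousLinearMap‖,
      ?_⟩
    rintro s ⟨u, hu, rfl⟩
    have := (LinearMap.toContinuousLinearMap
      (T : EuclideanSpace ℝ (Fin d) →ₗ[ℝ] EuclideanSpace ℝ (Fin d))).le_opNorm u
    simpa [hu] using this
  have hunit : ‖‖v‖⁻¹ • v‖ = 1 := by
    rw [norm_smul, norm_inv, norm_norm, inv_mul_cancel₀ hv'.ne']
  have hle : ‖T (‖v‖⁻¹ • v)‖ ≤ β := (le_csSup hbdd ⟨_, hunit, rfl⟩).trans hT.2.le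
  rw [map_smul, norm_smul, norm_inv, norm_norm, inv_mul_le_iff₀ hv'] at hle
  linarith

theorem norm_le_sSup_norm {ι E : Type*} [Finite ι] [Norm E] (x : ι → E) (i : ι) :
    ‖x i‖ ≤ sSup {s : ℝ | ∃ i, ‖x i‖ = s} :=
  le_csSup (Set.finite_range fun i => ‖x i‖).bddAbove ⟨i, rfl⟩

/-- The mesh size of the grid is at most twice the radius `M`. -/
theorem half_le_ceil_mul {d k : ℕ} (hd : 1 ≤ d) {α : ℝ} (hα0 : 0 < α) (hα1 : α < 1)
    (hk : 2 ≤ k) {x : Fin k → EuclideanSpace ℝ (Fin d)} (hx : Function.Injective x)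
    (hx0 : ∀ i, x i ≠ 0) {M : ℝ} (hM : M = sSup {s : ℝ | ∃ i, ‖x i‖ = s}) :
    1 / 2 ≤ (⌈d / (α * M * delta (Set.range x))⌉₊ : ℝ) * M := by
  have hxM (i) : ‖x i‖ ≤ M := hM ▸ norm_le_sSup_norm x i
  let i₀ : Fin k := ⟨0, by omega⟩
  let i₁ : Fin k := ⟨1, by omega⟩
  have hM0 : 0 < M := (norm_pos_iff.2 (hx0 i₀)).trans_le (hxM i₀)
  set D : Set ℝ := {s | ∃ y ∈ Set.range x, ∃ z ∈ Set.range x, y ≠ z ∧ ‖y - z‖ = s} with hD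
  have hdelta : delta (Set.range x) = sInf D / M := by
    rw [delta, hM]; simp [hD]
  have hmem : ‖x i₀ - x i₁‖ ∈ D :=
    ⟨_, ⟨i₀, rfl⟩, _, ⟨i₁, rfl⟩, hx.ne (by simp [i₀, i₁]), rfl⟩
  have hfin : D.Finite := by
    refine (Set.finite_range fun p : Fin k × Fin k => ‖x p.1 - x p.2‖).subset ?_
    rintro s ⟨_, ⟨i, rfl⟩, _, ⟨j, rfl⟩, -, rfl⟩
    exact ⟨(i, j), rfl⟩
  have hpos : 0 < sInf D := by
    obtain ⟨y, -, z, -, hyz, h⟩ := Set.Nonempty.csInf_mem ⟨_, hmem⟩ hfin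
    rw [← h]
    exact norm_pos_iff.2 (sub_ne_zero.2 hyz)
  have hle : sInf D ≤ 2 * M := by
    have := csInf_le hfin.bddBelow hmem
    have := norm_sub_le (x i₀) (x i₁)
    linarith [hxM i₀, hxM i₁]
  have hd' : (1 : ℝ) ≤ d := by exact_mod_cast hd
  have hprod : α * M * (sInf D / M) = α * sInf D := by field_simp
  rw [hdelta, hprod]
  calc (1 : ℝ) / 2 ≤ d / (α * sInf D) * M := by
        rw [div_mul_eq_mul_div, div_le_div_iff₀ (by norm_num) (by positivity)]
        nlinarith [mul_le_mul_of_nonneg_right hα1.le hpos.le,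
          mul_le_mul_of_nonneg_right hd' hM0.le]
    _ ≤ _ := by gcongr; exact Nat.le_ceil _

/-- Two integers in `[b - R, b + R]` lying above the same integers of that interval agree. -/
theorem int_eq_of_forall_le_iff {b v w : ℤ} {R : ℕ} (hv : |v - b| ≤ R) (hw : |w - b| ≤ R)
    (h : ∀ t : Fin (2 * R + 1), b - R + (t : ℕ) ≤ v ↔ b - R + (t : ℕ) ≤ w) : v = w := by
  rw [abs_le] at hv hw
  refine le_antisymm ?_ ?_
  · have := (h ⟨(v - b + R).toNat, by omega⟩).1 (by simp; omega)
    simp at this; omega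
  · have := (h ⟨(w - b + R).toNat, by omega⟩).2 (by simp; omega)
    simp at this; omega

theorem abs_floor_sub_floor_le {y z r : ℝ} (h : |y - z| ≤ r) :
    |⌊y⌋ - ⌊z⌋| ≤ ((⌈r⌉₊ + 1 : ℕ) : ℤ) := by
  have hr := Nat.le_ceil r
  rw [abs_le] at h ⊢
  have h1 := Int.floor_le y
  have h2 := Int.lt_floor_add_one y
  have h3 := Int.floor_le z
  have h4 := Int.lt_floor_add_one z
  constructor
  · have : (-((⌈r⌉₊ + 1 : ℕ) : ℤ) : ℝ) < (⌊y⌋ - ⌊z⌋ : ℤ) + 1 := by push_cast; linarith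
    have : -((⌈r⌉₊ + 1 : ℕ) : ℤ) < (⌊y⌋ - ⌊z⌋) + 1 := by exact_mod_cast this
    omega
  · have : ((⌊y⌋ - ⌊z⌋ : ℤ) : ℝ) < ((⌈r⌉₊ + 1 : ℕ) : ℤ) + 1 := by push_cast; linarith
    have : (⌊y⌋ - ⌊z⌋) < ((⌈r⌉₊ + 1 : ℕ) : ℤ) + 1 := by exact_mod_cast this
    omega

theorem floor_mul_eq_of_mem_gridCube {d L : ℕ} (hL : 0 < L) {j : Fin d → ℕ}
    {y : EuclideanSpace ℝ (Fin d)} (hy : y ∈ gridCube d L j) (i : Fin d) :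
    ⌊(L : ℝ) * y i⌋ = j i ∧ ∀ l : ℤ, (L : ℝ) * y i ≠ l := by
  have hL' : (0 : ℝ) < L := by exact_mod_cast hL
  obtain ⟨h1, h2⟩ := hy i
  rw [div_lt_iff₀ hL'] at h1
  rw [lt_div_iff₀ hL'] at h2
  refine ⟨Int.floor_eq_iff.2 ⟨by push_cast; linarith, by push_cast; linarith⟩, ?_⟩
  intro l hl
  have h3 : ((j i : ℤ) : ℝ) < l := by push_cast; linarith
  have h4 : (l : ℝ) < ((j i + 1 : ℤ) : ℝ) := by push_cast; linarith
  have h3 := Int.cast_lt.1 h3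
  have h4 := Int.cast_lt.1 h4
  omega

theorem mem_gridCube_of_floor {d L : ℕ} (hL : 0 < L) {j : Fin d → ℕ}
    {y : EuclideanSpace ℝ (Fin d)} (h : ∀ i, ⌊(L : ℝ) * y i⌋ = j i)
    (hne : ∀ i, ∀ l : ℤ, (L : ℝ) * y i ≠ l) : y ∈ gridCube d L j := by
  have hL' : (0 : ℝ) < L := by exact_mod_cast hL
  intro i
  rw [div_lt_iff₀ hL', lt_div_iff₀ hL']
  obtain ⟨h1, h2⟩ := Int.floor_eq_iff.1 (h i)
  have h3 := lt_of_le_of_ne h1 (hne i _).symm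
  push_cast at h2 h3
  constructor <;> linarith

/-- **Reduction to a finite set of linear maps** (Lemma 2.4).
There is a constant `C = C(α, d) > 0` such that: for any finite set
`A₀ = {x_1, …, x_k}` of nonzero vectors, any `x ∈ [0,1]^d`, with
`M = max ‖x_i‖`, `δ = δ(A₀)`, `L = ⌈d/(αMδ)⌉`, there is a finite set
`S ⊆ S_α^{1/α}` with `#S ≤ C (L M k)^{d²}` such that whenever `E ⊆ [0,1]^d` is a
union of open grid cubes of side `1/L` and `T A₀ + x ⊆ E` for some `T ∈ S_α^{1/α}`,
then `S' A₀ + x ⊆ E` for some `S' ∈ S`. -/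
theorem stmt8 (d : ℕ) (hd : 1 ≤ d) (α : ℝ) (hα0 : 0 < α) (hα1 : α < 1) :
    ∃ C : ℝ, 0 < C ∧
      ∀ (k : ℕ), 2 ≤ k →
      ∀ x : Fin k → EuclideanSpace ℝ (Fin d), Function.Injective x →
        (∀ i, x i ≠ 0) →
      ∀ pt ∈ unitCube d,
      ∀ M : ℝ, M = sSup {s : ℝ | ∃ i, ‖x i‖ = s} →
      ∀ δ : ℝ, δ = delta (Set.range x) →
      ∀ L : ℕ, L = ⌈d / (α * M * δ)⌉₊ →
      ∃ S : Set (EuclideanSpace ℝ (Fin d) ≃ₗ[ℝ] EuclideanSpace ℝ (Fin d)),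
        S.Finite ∧ (∀ T ∈ S, memS α (1 / α) T) ∧
        (S.ncard : ℝ) ≤ C * ((L : ℝ) * M * (k : ℝ)) ^ (d ^ 2) ∧
        ∀ E : Set (EuclideanSpace ℝ (Fin d)), E ⊆ unitCube d →
          (∃ J : Set (Fin d → ℕ), (∀ j ∈ J, ∀ i, j i < L) ∧
            E = ⋃ j ∈ J, gridCube d L j) →
          (∃ T : EuclideanSpace ℝ (Fin d) ≃ₗ[ℝ] EuclideanSpace ℝ (Fin d),
            memS α (1 / α) T ∧ (fun a => T a + pt) '' Set.range x ⊆ E) →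
          ∃ S' ∈ S, (fun a => S' a + pt) '' Set.range x ⊆ E := by
  refine ⟨((d ^ 2 : ℕ) + 1) * (d * (2 / α + 10)) ^ (d ^ 2), by positivity, ?_⟩
  intro k hk x hx hx0 pt _ M hM δ hδ L hL
  have hLM : 1 / 2 ≤ (L : ℝ) * M := by
    subst hδ hL; exact half_le_ceil_mul hd hα0 hα1 hk hx hx0 hM
  have hL0 : 0 < L := by
    rcases Nat.eq_zero_or_pos L with h | h
    · norm_num [h] at hLM
    · exact h
  set R : ℕ := ⌈(L : ℝ) * M / α⌉₊ + 1 with hR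
  let ι := Fin k × Fin d × Fin (2 * R + 1)
  have : Nonempty ι := ⟨⟨0, by omega⟩, ⟨0, by omega⟩, 0⟩
  let V := EuclideanSpace ℝ (Fin d) →ₗ[ℝ] EuclideanSpace ℝ (Fin d)
  let f : ι → Module.Dual ℝ V := fun p =>
    { toFun := fun T => (L : ℝ) * T (x p.1) p.2.1
      map_add' := fun S T => mul_add _ _ _
      map_smul' := fun c T => mul_left_comm _ _ _ }
  let a : ι → ℝ := fun p =>
    (L : ℝ) * pt p.2.1 - ((⌊(L : ℝ) * pt p.2.1⌋ - R + (p.2.2 : ℕ) : ℤ) : ℝ)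
  let good : Set (EuclideanSpace ℝ (Fin d) ≃ₗ[ℝ] EuclideanSpace ℝ (Fin d)) :=
    {T | memS α (1 / α) T ∧ ∀ i m, ∀ l : ℤ, (L : ℝ) * (T (x i) + pt) m ≠ l}
  let pat : (EuclideanSpace ℝ (Fin d) ≃ₗ[ℝ] EuclideanSpace ℝ (Fin d)) → Finset ι :=
    fun T => nonnegPattern f a (T : V)
  have hpat (T : EuclideanSpace ℝ (Fin d) ≃ₗ[ℝ] EuclideanSpace ℝ (Fin d)) (i m t) :
      (i, m, t) ∈ pat T ↔
        ⌊(L : ℝ) * pt m⌋ - R + (t : ℕ) ≤ ⌊(L : ℝ) * (T (x i) + pt) m⌋ := by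
    rw [mem_nonnegPattern, Int.le_floor, ← sub_nonneg (a := (L : ℝ) * (T (x i) + pt) m)]
    have : f (i, m, t) (T : V) + a (i, m, t) = (L : ℝ) * (T (x i) + pt) m -
        ((⌊(L : ℝ) * pt m⌋ - R + (t : ℕ) : ℤ) : ℝ) := by
      change (L : ℝ) * T (x i) m + (L * pt m - _) = L * (T (x i) m + pt m) - _
      ring
    rw [this]
  have hnear (T) (hT : T ∈ good) (i m) :
      |⌊(L : ℝ) * (T (x i) + pt) m⌋ - ⌊(L : ℝ) * pt m⌋| ≤ (R : ℤ) := by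
    refine abs_floor_sub_floor_le ?_
    have h1 : |T (x i) m| ≤ ‖T (x i)‖ := PiLp.norm_apply_le (T (x i)) m
    have h2 := norm_apply_le_of_memS hT.1 (x i)
    have h3 : ‖x i‖ ≤ M := hM ▸ norm_le_sSup_norm x i
    have h4 : 1 / α * ‖x i‖ ≤ 1 / α * M := by gcongr
    have h5 : (L : ℝ) * (T (x i) + pt) m - (L : ℝ) * pt m = L * T (x i) m := by
      simp; ring
    rw [h5, abs_mul, Nat.abs_cast, mul_div_assoc]
    gcongr
    calc _ ≤ 1 / α * M := by linarith
      _ = M / α := by ring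
  choose! rep hrep using fun A (hA : A ∈ pat '' good) => hA
  refine ⟨rep '' (pat '' good), (Set.toFinite _).image _, ?_, ?_, ?_⟩
  · rintro _ ⟨A, hA, rfl⟩
    exact (hrep A hA).1.1
  · have h1 : (rep '' (pat '' good)).ncard ≤ (d ^ 2 + 1) * (k * (d * (2 * R + 1))) ^ (d ^ 2) := by
      have hrank : Module.finrank ℝ V = d ^ 2 := by
        simp [V, Module.finrank_linearMap, sq]
      have hcard : Fintype.card ι = k * (d * (2 * R + 1)) := by simp [ι]
      have := ncard_range_nonnegPattern_le f a
      rw [hrank, hcard] at this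
      refine (Set.ncard_image_le (Set.toFinite _)).trans (le_trans ?_ this)
      refine Set.ncard_le_ncard ?_ (Set.toFinite _)
      rintro _ ⟨T, -, rfl⟩
      exact ⟨_, rfl⟩
    have hRle : (2 * R + 1 : ℝ) ≤ (2 / α + 10) * (L * M) := by
      have h2 : (⌈(L : ℝ) * M / α⌉₊ : ℝ) < (L : ℝ) * M / α + 1 :=
        Nat.ceil_lt_add_one (by positivity)
      have h3 : (2 / α + 10) * (L * M) = 2 * ((L : ℝ) * M / α) + 10 * (L * M) := by ring
      rw [h3, hR]
      push_cast
      linarith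
    calc ((rep '' (pat '' good)).ncard : ℝ)
        ≤ ((d ^ 2 : ℕ) + 1) * (k * (d * (2 * R + 1))) ^ (d ^ 2) := by exact_mod_cast h1
      _ ≤ ((d ^ 2 : ℕ) + 1) * (k * (d * ((2 / α + 10) * (L * M)))) ^ (d ^ 2) := by gcongr
      _ = _ := by rw [mul_assoc, ← mul_pow]; ring_nf
  · rintro E - ⟨J, -, rfl⟩ ⟨T, hT, hTE⟩
    have hcube (i) : ∃ j ∈ J, T (x i) + pt ∈ gridCube d L j := by
      simpa using hTE ⟨x i, ⟨i, rfl⟩, rfl⟩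
    have hgood : T ∈ good := ⟨hT, fun i m => by
      obtain ⟨j, -, hj⟩ := hcube i
      exact (floor_mul_eq_of_mem_gridCube hL0 hj m).2⟩
    have hA : pat T ∈ pat '' good := ⟨T, hgood, rfl⟩
    obtain ⟨hS, hST⟩ := hrep _ hA
    refine ⟨rep (pat T), ⟨_, hA, rfl⟩, ?_⟩
    rintro _ ⟨_, ⟨i, rfl⟩, rfl⟩
    obtain ⟨j, hjJ, hj⟩ := hcube i
    refine Set.mem_biUnion hjJ (mem_gridCube_of_floor hL0 (fun m => ?_) (hS.2 i))
    rw [← (floor_mul_eq_of_mem_gridCube hL0 hj m).1]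
    refine int_eq_of_forall_le_iff (hnear _ hS i m) (hnear _ hgood i m) fun t => ?_
    rw [← hpat, ← hpat, hST]
end
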